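/- arXiv:1409.2229 — 6 statements merged into one kernel-verified Lean document; each statement's English description precedes it below -/
import Mathlib

section
/- Let k > 2 be an integer and γ₁,…,γ_{k−1} real numbers with at least two of the γᵢ nonzero; let P(x,b) = ∑_{i=1}^{k−1} γᵢ bⁱ x^{k−i} and S = {y = a + P(x,b)} ⊂ ℝ⁴. Then there exists a nonzero vector field of the form V = d∂_x + c∂_b + α₀ b^{k−1} ∂_a + η₀ x^{k−1} ∂_y (with real constants c, d, α₀, η₀) tangent to S if and only if there exist nonzero real numbers δ and ν such that γᵢ = C(k,i)·δ·νᶦ for all 1 ≤ i ≤ k−1, i.e. if and only if P(x,b) = δ·[(x+νb)^k − x^k − (νb)^k]. -/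
/-- The polynomial `P(x,b) = ∑_{i=1}^{k-1} γᵢ bⁱ x^{k-i}`. -/
def Ppoly (k : ℕ) (γ : ℕ → ℝ) (x b : ℝ) : ℝ :=
  ∑ i ∈ Finset.Icc 1 (k - 1), γ i * b ^ i * x ^ (k - i)

/-- The one-variable polynomial `P(1,b)`. -/
noncomputable def ppol (k : ℕ) (γ : ℕ → ℝ) : Polynomial ℝ :=
  ∑ i ∈ Finset.Icc 1 (k - 1), Polynomial.C (γ i) * Polynomial.X ^ i

lemma ppol_coeff (k : ℕ) (γ : ℕ → ℝ) (n : ℕ) :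
    (ppol k γ).coeff n = if n ∈ Finset.Icc 1 (k - 1) then γ n else 0 := by
  simp only [ppol, Polynomial.finsetSum_coeff, Polynomial.coeff_C_mul_X_pow]
  rw [Finset.sum_ite_eq]

lemma ppol_eval (k : ℕ) (γ : ℕ → ℝ) (t : ℝ) : (ppol k γ).eval t = Ppoly k γ 1 t := by
  simp [ppol, Ppoly, Polynomial.eval_finsetSum]

lemma deriv_x (k : ℕ) (γ : ℕ → ℝ) (b : ℝ) :
    deriv (fun t => Ppoly k γ t b) 1 =
      (Polynomial.C (k : ℝ) * ppol k γ - Polynomial.X * (ppol k γ).derivative).eval b := by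
  have h : HasDerivAt (fun t => Ppoly k γ t b)
      (∑ i ∈ Finset.Icc 1 (k - 1), γ i * b ^ i * (((k - i : ℕ) : ℝ) * 1 ^ (k - i - 1))) 1 := by
    unfold Ppoly
    apply HasDerivAt.fun_sum
    intro i _
    exact (hasDerivAt_pow (k - i) (1 : ℝ)).const_mul _
  rw [h.deriv]
  simp only [ppol, Polynomial.derivative_sum, Finset.mul_sum, ← Finset.sum_sub_distrib,
    Polynomial.eval_finsetSum]
  apply Finset.sum_congr rfl
  intro i hi
  rw [Finset.mem_Icc] at hi
  obtain ⟨j, rfl⟩ : ∃ j, i = j + 1 := ⟨i - 1, by omega⟩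
  rw [Nat.cast_sub (by omega)]
  simp [Polynomial.derivative_X_pow]
  ring

lemma closed_form (k : ℕ) (hk : 2 < k) (γ : ℕ → ℝ) (δ ν : ℝ)
    (h : ∀ i ∈ Finset.Icc 1 (k - 1), γ i = (k.choose i : ℝ) * δ * ν ^ i) (x b : ℝ) :
    Ppoly k γ x b = δ * ((x + ν * b) ^ k - x ^ k - (ν * b) ^ k) := by
  obtain ⟨n, rfl⟩ : ∃ n, k = n + 1 := ⟨k - 1, by omega⟩
  have e : Finset.Icc 1 (n + 1 - 1) = Finset.Ico 1 (n + 1) := by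
    ext; simp only [Finset.mem_Icc, Finset.mem_Ico]; omega
  have e2 : Ppoly (n + 1) γ x b = ∑ i ∈ Finset.Icc 1 (n + 1 - 1),
      δ * ((ν * b) ^ i * x ^ (n + 1 - i) * ((n + 1).choose i : ℝ)) := by
    apply Finset.sum_congr rfl
    intro i hi
    rw [h i hi]
    ring
  rw [e2, ← Finset.mul_sum, add_comm x, add_pow, Finset.sum_range_succ, Finset.sum_range_succ', e,
    Finset.sum_Ico_eq_sum_range]
  simp [add_comm 1]
  left
  ring

lemma tangent_coeff (k : ℕ) (γ : ℕ → ℝ) (c d α₀ η₀ : ℝ)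
    (h : ∀ b : ℝ, α₀ * b ^ (k - 1) + c * deriv (fun t => Ppoly k γ 1 t) b
          + d * deriv (fun t => Ppoly k γ t b) 1 - η₀ * 1 ^ (k - 1) = 0) (n : ℕ) :
    (if n = k - 1 then α₀ else 0) + c * ((ppol k γ).coeff (n + 1) * (n + 1))
      + d * ((k - n) * (ppol k γ).coeff n) - (if n = 0 then η₀ else 0) = 0 := by
  have hQ : Polynomial.C α₀ * Polynomial.X ^ (k - 1) + Polynomial.C c * (ppol k γ).derivative
      + Polynomial.C d * (Polynomial.C (k : ℝ) * ppol k γ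
        - Polynomial.X * (ppol k γ).derivative) - Polynomial.C η₀ = 0 := by
    apply Polynomial.funext
    intro b
    have := h b
    rw [deriv_x] at this
    simp only [← ppol_eval, Polynomial.deriv] at this
    simp only [Polynomial.eval_add, Polynomial.eval_sub, Polynomial.eval_mul, Polynomial.eval_C,
      Polynomial.eval_pow, Polynomial.eval_X, Polynomial.eval_zero, one_pow] at this ⊢
    linarith
  have hc := congrArg (fun p => Polynomial.coeff p n) hQ
  simp only [Polynomial.coeff_add, Polynomial.coeff_sub, Polynomial.coeff_X_pow, mul_ite, mul_one, mul_zero,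
    Polynomial.coeff_C_mul, Polynomial.coeff_derivative, Polynomial.coeff_C,
    Polynomial.coeff_zero] at hc
  have hx : (Polynomial.X * (ppol k γ).derivative).coeff n = n * (ppol k γ).coeff n := by
    cases n with
    | zero => simp
    | succ m => rw [Polynomial.coeff_X_mul, Polynomial.coeff_derivative]; push_cast; ring
  rw [hx] at hc
  linear_combination hc

/-- for `k > 2` and `P(x,b) = ∑_{i=1}^{k-1} γᵢ bⁱ x^{k-i}` with at
least two nonzero `γᵢ`, the hypersurface `S = {y = a + P(x,b)}` admits a nonzero
tangent vector field of the form
`V = d∂_x + c∂_b + α₀ b^{k-1} ∂_a + η₀ x^{k-1} ∂_y`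
iff there are nonzero `δ, ν` with `γᵢ = C(k,i) δ νⁱ` for all `1 ≤ i ≤ k−1`,
i.e. iff `P(x,b) = δ[(x+νb)^k − x^k − (νb)^k]`. -/
theorem stmt_13
    (k : ℕ) (hk : 2 < k) (γ : ℕ → ℝ)
    (h2 : ∃ i ∈ Finset.Icc 1 (k - 1), ∃ j ∈ Finset.Icc 1 (k - 1),
      i ≠ j ∧ γ i ≠ 0 ∧ γ j ≠ 0) :
    (∃ c d α₀ η₀ : ℝ, ¬ (c = 0 ∧ d = 0 ∧ α₀ = 0 ∧ η₀ = 0) ∧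
      ∀ x a b : ℝ,
        α₀ * b ^ (k - 1) + c * deriv (fun t => Ppoly k γ x t) b
          + d * deriv (fun t => Ppoly k γ t b) x
          - η₀ * x ^ (k - 1) = 0) ↔
    (∃ δ ν : ℝ, δ ≠ 0 ∧ ν ≠ 0 ∧
      (∀ i ∈ Finset.Icc 1 (k - 1), γ i = (k.choose i : ℝ) * δ * ν ^ i) ∧
      (∀ x b : ℝ, Ppoly k γ x b = δ * ((x + ν * b) ^ k - x ^ k - (ν * b) ^ k))) := by
  constructor
  · rintro ⟨c, d, α₀, η₀, hne, ht⟩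
    have hco := tangent_coeff k γ c d α₀ η₀ (fun b => ht 1 0 b)
    have hrec : ∀ n, 1 ≤ n → n + 1 ≤ k - 1 →
        c * (γ (n + 1) * (n + 1)) + d * ((k - n) * γ n) = 0 := by
      intro n h1 h3
      have := hco n
      rw [ppol_coeff, ppol_coeff, if_neg (by omega),
        if_pos (by rw [Finset.mem_Icc]; omega), if_pos (by rw [Finset.mem_Icc]; omega),
        if_neg (by omega)] at this
      linarith
    have hη : c * γ 1 = η₀ := by
      have := hco 0
      rw [ppol_coeff, ppol_coeff, if_neg (by omega), if_pos (by rw [Finset.mem_Icc]; omega),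
        if_neg (by simp), if_pos rfl] at this
      push_cast at this
      simp only [zero_add] at this
      linarith
    have hα : α₀ + d * γ (k - 1) = 0 := by
      have := hco (k - 1)
      rw [ppol_coeff, ppol_coeff, if_pos rfl, if_neg (by rw [Finset.mem_Icc]; omega),
        if_pos (by rw [Finset.mem_Icc]; omega), if_neg (by omega),
        Nat.cast_sub (by omega)] at this
      push_cast at this
      linarith
    obtain ⟨i, hi, j, hj, hij, hgi, hgj⟩ := h2
    rw [Finset.mem_Icc] at hi hj
    have hc : c ≠ 0 := by
      rintro rfl
      have hd : d = 0 := by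
        by_contra hd
        have hz : ∀ n, 1 ≤ n → n + 1 ≤ k - 1 → γ n = 0 := by
          intro n h1 h3
          have := hrec n h1 h3
          have hkn : (k : ℝ) - n ≠ 0 := by
            have : (n : ℝ) < k := by exact_mod_cast (by omega : n < k)
            linarith
          simpa [hd, hkn] using this
        rcases Nat.lt_or_ge i (k - 1) with h | h
        · exact hgi (hz i hi.1 h)
        · exact hgj (hz j hj.1 (by omega))
      subst hd
      exact hne ⟨rfl, rfl, by linarith, by linarith⟩
    have hstep : ∀ n, 1 ≤ n → n + 1 ≤ k - 1 →
        γ (n + 1) * (n + 1) = (-d / c) * ((k - n) * γ n) := by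
      intro n h1 h3
      have := hrec n h1 h3
      field_simp
      linarith
    have hd : d ≠ 0 := by
      rintro rfl
      have hz : ∀ n, 2 ≤ n → n ≤ k - 1 → γ n = 0 := by
        intro n h1 h3
        obtain ⟨m, rfl⟩ : ∃ m, n = m + 1 := ⟨n - 1, by omega⟩
        have := hstep m (by omega) h3
        have hm : (m : ℝ) + 1 ≠ 0 := by positivity
        simpa [hm] using this
      rcases Nat.lt_or_ge 1 i with h | h
      · exact hgi (hz i h hi.2)
      · exact hgj (hz j (by omega) hj.2)
    have hν : -d / c ≠ 0 := div_ne_zero (neg_ne_zero.mpr hd) hc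
    generalize -d / c = ν at hstep hν
    have hk0 : (k : ℝ) ≠ 0 := by
      have : k ≠ 0 := by omega
      exact_mod_cast this
    have hform : ∀ n, 1 ≤ n → n ≤ k - 1 →
        γ n = (k.choose n : ℝ) * (γ 1 / (k * ν)) * ν ^ n := by
      intro n h1
      induction n, h1 using Nat.le_induction with
      | base => intro _; rw [Nat.choose_one_right]; field_simp
      | succ n h1 ih =>
        intro h3
        have hs := hstep n h1 h3
        rw [ih (by omega)] at hs
        have hch : (k.choose (n + 1) : ℝ) * (n + 1) = k.choose n * (k - n) := by
          have := Nat.choose_succ_right_eq k n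
          rw [← Nat.cast_sub (by omega)]
          exact_mod_cast this
        have hm : (n : ℝ) + 1 ≠ 0 := by positivity
        apply mul_right_cancel₀ hm
        rw [hs, pow_succ]
        linear_combination (-(γ 1 / (k * ν)) * ν ^ n * ν) * hch
    have hform' : ∀ n ∈ Finset.Icc 1 (k - 1),
        γ n = (k.choose n : ℝ) * (γ 1 / (k * ν)) * ν ^ n := by
      intro n hn
      rw [Finset.mem_Icc] at hn
      exact hform n hn.1 hn.2
    refine ⟨γ 1 / (k * ν), ν, ?_, hν, hform', closed_form k hk γ _ _ hform'⟩
    intro h0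
    apply hgi
    rw [hform i hi.1 hi.2, h0]
    simp
  · rintro ⟨δ, ν, hδ, hν, -, hP⟩
    refine ⟨1, -ν, δ * k * ν ^ k, δ * k * ν, by simp, ?_⟩
    intro x _ b
    obtain ⟨n, rfl⟩ : ∃ n, k = n + 1 := ⟨k - 1, by omega⟩
    simp only [hP]
    have hb : HasDerivAt (fun t => δ * ((x + ν * t) ^ (n + 1) - x ^ (n + 1) - (ν * t) ^ (n + 1)))
        (δ * (((n + 1 : ℕ) : ℝ) * (x + ν * b) ^ n * (ν * 1)
          - ((n + 1 : ℕ) : ℝ) * (ν * b) ^ n * (ν * 1))) b := by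
      have h1 := ((hasDerivAt_id' b).const_mul ν)
      exact ((((h1.const_add x).fun_pow (n + 1)).sub_const (x ^ (n + 1))).fun_sub
        (h1.fun_pow (n + 1))).const_mul δ
    have hx : HasDerivAt (fun t => δ * ((t + ν * b) ^ (n + 1) - t ^ (n + 1) - (ν * b) ^ (n + 1)))
        (δ * (((n + 1 : ℕ) : ℝ) * (x + ν * b) ^ n * 1
          - ((n + 1 : ℕ) : ℝ) * x ^ n * 1)) x := by
      have h1 := (hasDerivAt_id' x)
      exact ((((h1.add_const (ν * b)).fun_pow (n + 1)).fun_sub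
        (h1.fun_pow (n + 1))).sub_const ((ν * b) ^ (n + 1))).const_mul δ
    rw [hb.deriv, hx.deriv]
    simp only [Nat.add_sub_cancel, mul_pow, pow_succ]
    ring
end

section
/- Let k > 2 be an integer and δ, ν nonzero real numbers. Then the map Ψ: ℝ⁴ → ℝ⁴ defined by Ψ(x,y,a,b) = (x, y/δ + x^k, a/δ − ν^k b^k, νb) is a para-holomorphic diffeomorphism of ℝ⁴ onto itself, and it maps the hypersurface {y = a + δ·[(x+νb)^k − x^k − (νb)^k]} bijectively onto the hypersurface {y = a + (x+b)^k}. -/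
/-- for `k > 2` and nonzero `δ, ν`, the map
`Ψ(x,y,a,b) = (x, y/δ + x^k, a/δ − ν^k b^k, νb)` is a para-holomorphic
diffeomorphism of `ℝ⁴ = ℝ²_{xy} × ℝ²_{ab}` (coordinates `(x,y,a,b)`) onto itself
and maps `{y = a + δ[(x+νb)^k − x^k − (νb)^k]}` bijectively onto
`{y = a + (x+b)^k}`. -/
theorem stmt_14
    (k : ℕ) (hk : 2 < k) (δ ν : ℝ) (hδ : δ ≠ 0) (hν : ν ≠ 0)
    (Ψ : (ℝ × ℝ × ℝ × ℝ) → ℝ × ℝ × ℝ × ℝ)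
    (hΨ : Ψ = fun q => (q.1, q.2.1 / δ + q.1 ^ k,
      q.2.2.1 / δ - ν ^ k * q.2.2.2 ^ k, ν * q.2.2.2))
    (S₁ S₂ : Set (ℝ × ℝ × ℝ × ℝ))
    (hS₁ : S₁ = {q : ℝ × ℝ × ℝ × ℝ |
      q.2.1 = q.2.2.1 + δ * ((q.1 + ν * q.2.2.2) ^ k - q.1 ^ k - (ν * q.2.2.2) ^ k)})
    (hS₂ : S₂ = {q : ℝ × ℝ × ℝ × ℝ | q.2.1 = q.2.2.1 + (q.1 + q.2.2.2) ^ k}) :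
    -- para-holomorphic: the (x,y)-components depend only on (x,y),
    -- the (a,b)-components only on (a,b)
    (∀ q q' : ℝ × ℝ × ℝ × ℝ, q.1 = q'.1 → q.2.1 = q'.2.1 →
      (Ψ q).1 = (Ψ q').1 ∧ (Ψ q).2.1 = (Ψ q').2.1) ∧
    (∀ q q' : ℝ × ℝ × ℝ × ℝ, q.2.2 = q'.2.2 →
      (Ψ q).2.2 = (Ψ q').2.2) ∧
    -- a smooth diffeomorphism of ℝ⁴ onto itself
    ContDiff ℝ (⊤ : ℕ∞) Ψ ∧ Function.Bijective Ψ ∧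
    (∃ Ψinv : (ℝ × ℝ × ℝ × ℝ) → ℝ × ℝ × ℝ × ℝ,
      ContDiff ℝ (⊤ : ℕ∞) Ψinv ∧ Function.LeftInverse Ψinv Ψ ∧
      Function.RightInverse Ψinv Ψ) ∧
    -- maps S₁ bijectively onto S₂
    Ψ '' S₁ = S₂ ∧ Set.InjOn Ψ S₁ := by
  have hmem : ∀ q, Ψ q ∈ S₂ ↔ q ∈ S₁ := by
    rintro ⟨x, y, a, b⟩
    subst hΨ hS₁ hS₂
    simp only [Set.mem_setOf_eq]
    rw [← mul_pow]
    constructor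
    · intro h
      have h2 : δ * (y / δ + x ^ k) = δ * (a / δ - (ν * b) ^ k + (x + ν * b) ^ k) := by rw [h]
      have e1 : δ * (y / δ) = y := by field_simp
      have e2 : δ * (a / δ) = a := by field_simp
      linear_combination h2 - e1 + e2
    · intro h
      rw [h]
      field_simp
      ring
  let Φ : (ℝ × ℝ × ℝ × ℝ) → ℝ × ℝ × ℝ × ℝ := fun q =>
    (q.1, δ * (q.2.1 - q.1 ^ k), δ * (q.2.2.1 + q.2.2.2 ^ k), q.2.2.2 / ν)
  have hL : Function.LeftInverse Φ Ψ := by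
    rintro ⟨x, y, a, b⟩
    subst hΨ
    simp only [Φ, Prod.mk.injEq, true_and]
    refine ⟨?_, ?_, ?_⟩
    · field_simp
      ring
    · rw [mul_pow]
      field_simp
      ring
    · field_simp
  have hR : Function.RightInverse Φ Ψ := by
    rintro ⟨x, y, a, b⟩
    subst hΨ
    simp only [Φ, Prod.mk.injEq, true_and]
    refine ⟨?_, ?_, ?_⟩
    · field_simp
      ring
    · rw [← mul_pow, mul_div_cancel₀ _ hν, mul_div_cancel_left₀ _ hδ]
      ring
    · field_simp
  refine ⟨?_, ?_, ?_, ⟨hL.injective, hR.surjective⟩, ⟨Φ, ?_, hL, hR⟩, ?_, hL.injective.injOn⟩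
  · intro q q' h1 h2
    subst hΨ
    simp [h1, h2]
  · intro q q' h
    subst hΨ
    simp [h]
  · subst hΨ
    simp only [div_eq_mul_inv]
    fun_prop
  · simp only [Φ, div_eq_mul_inv]
    fun_prop
  · ext p
    constructor
    · rintro ⟨q, hq, rfl⟩
      exact (hmem q).2 hq
    · intro hp
      refine ⟨Φ p, (hmem _).1 ?_, hR p⟩
      rwa [hR p]
end

section
/- Fix an integer k > 2 and real numbers γ₁,…,γ_{k−1}, not all zero; let P(x,b) = ∑_{i=1}^{k−1} γᵢ bⁱ x^{k−i} and S = {y = a + P(x,b)} ⊂ ℝ⁴. Then for every integer ℓ with 1 ≤ ℓ ≤ k−2, any vector field of the form V = ξ₀ x^{ℓ+1} ∂_x + (η₀ x^{k+ℓ} + η₁ x^ℓ y) ∂_y + (α₀ b^{k+ℓ} + α₁ a b^ℓ) ∂_a + β₀ b^{ℓ+1} ∂_b (real constants ξ₀, η₀, η₁, α₀, α₁, β₀) that is tangent to S is identically zero. In other words, S admits no nonzero weighted-homogeneous infinitesimal multicontact automorphism of weight ℓ for 1 ≤ ℓ ≤ k−2. -/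
/-- for `k > 2`, `γ₁,…,γ_{k−1}` not all zero,
`S = {y = a + ∑ γᵢ bⁱ x^{k-i}}` and `1 ≤ ℓ ≤ k−2`, every vector field of the
weighted-homogeneous (weight `ℓ`) para-holomorphic form
`V = ξ₀ x^{ℓ+1} ∂_x + (η₀ x^{k+ℓ} + η₁ x^ℓ y) ∂_y + (α₀ b^{k+ℓ} + α₁ a b^ℓ) ∂_a
  + β₀ b^{ℓ+1} ∂_b`
that is tangent to `S` is identically zero. -/
theorem stmt_15
    (k : ℕ) (hk : 2 < k) (γ : ℕ → ℝ)
    (hγ : ∃ i ∈ Finset.Icc 1 (k - 1), γ i ≠ 0)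
    (ℓ : ℕ) (hℓ₁ : 1 ≤ ℓ) (hℓ₂ : ℓ ≤ k - 2)
    (ξ₀ η₀ η₁ α₀ α₁ β₀ : ℝ)
    (htang : ∀ x a b : ℝ,
      (α₀ * b ^ (k + ℓ) + α₁ * a * b ^ ℓ)
        + (β₀ * b ^ (ℓ + 1)) * deriv (fun t => Ppoly k γ x t) b
        + (ξ₀ * x ^ (ℓ + 1)) * deriv (fun t => Ppoly k γ t b) x
        - (η₀ * x ^ (k + ℓ) + η₁ * x ^ ℓ * (a + Ppoly k γ x b)) = 0) :
    ξ₀ = 0 ∧ η₀ = 0 ∧ η₁ = 0 ∧ α₀ = 0 ∧ α₁ = 0 ∧ β₀ = 0 := by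
  have hPx : ∀ x b : ℝ, deriv (fun t => Ppoly k γ x t) b =
      ∑ i ∈ Finset.Icc 1 (k - 1), γ i * (i * b ^ (i - 1)) * x ^ (k - i) := by
    intro x b
    apply HasDerivAt.deriv
    unfold Ppoly
    apply HasDerivAt.fun_sum
    intro i _
    exact ((hasDerivAt_pow i b).const_mul (γ i)).mul_const _
  have hPt : ∀ x b : ℝ, deriv (fun t => Ppoly k γ t b) x =
      ∑ i ∈ Finset.Icc 1 (k - 1), γ i * b ^ i * (((k - i : ℕ) : ℝ) * x ^ (k - i - 1)) := by
    intro x b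
    apply HasDerivAt.deriv
    unfold Ppoly
    apply HasDerivAt.fun_sum
    intro i _
    exact (hasDerivAt_pow (k - i) x).const_mul _
  have hD0 : ∀ b : ℝ, deriv (fun t => Ppoly k γ 0 t) b = 0 := by
    intro b
    rw [hPx]
    apply Finset.sum_eq_zero
    intro i hi
    rw [Finset.mem_Icc] at hi
    rw [zero_pow (by omega), mul_zero]
  have hE0 : ∀ x : ℝ, deriv (fun t => Ppoly k γ t 0) x = 0 := by
    intro x
    rw [hPt]
    apply Finset.sum_eq_zero
    intro i hi
    rw [Finset.mem_Icc] at hi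
    rw [zero_pow (by omega), mul_zero, zero_mul]
  have hl : ℓ ≠ 0 := by omega
  have h1 := htang 0 0 1
  have h2 := htang 0 1 1
  have h3 := htang 1 0 0
  have h4 := htang 1 1 0
  rw [hD0] at h1 h2
  rw [hE0] at h3 h4
  simp [hl] at h1 h2 h3 h4
  have hα₀ : α₀ = 0 := by linarith
  have hα₁ : α₁ = 0 := by linarith
  have hη₁ : η₁ = 0 := by linarith
  have hη₀ : η₀ = 0 := by
    rw [hη₁] at h3
    linarith
  let F : Polynomial ℝ := ∑ i ∈ Finset.Icc 1 (k - 1),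
    (Polynomial.C (β₀ * (γ i * i)) * Polynomial.X ^ (i + ℓ)
      + Polynomial.C (ξ₀ * (γ i * ((k - i : ℕ) : ℝ))) * Polynomial.X ^ i)
  have hF : F = 0 := by
    apply Polynomial.funext
    intro b
    have h := htang 1 0 b
    rw [hPx, hPt, hα₀, hα₁, hη₀, hη₁] at h
    simp only [one_pow, mul_one, zero_mul, mul_zero, add_zero, zero_add, sub_zero] at h
    rw [Finset.mul_sum, Finset.mul_sum, ← Finset.sum_add_distrib] at h
    simp only [F, Polynomial.eval_finset_sum, Polynomial.eval_zero]
    rw [← h]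
    apply Finset.sum_congr rfl
    intro i hi
    rw [Finset.mem_Icc] at hi
    obtain ⟨j, rfl⟩ : ∃ j, i = j + 1 := ⟨i - 1, by omega⟩
    simp only [Polynomial.eval_add, Polynomial.eval_mul, Polynomial.eval_C, Polynomial.eval_pow,
      Polynomial.eval_X, Nat.add_sub_cancel]
    ring
  have hc : ∀ n, (∑ i ∈ Finset.Icc 1 (k - 1), if n = i + ℓ then β₀ * (γ i * i) else 0)
      + (∑ i ∈ Finset.Icc 1 (k - 1),
        if n = i then ξ₀ * (γ i * ((k - i : ℕ) : ℝ)) else 0) = 0 := by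
    intro n
    have h := congrArg (fun p => Polynomial.coeff p n) hF
    simp only [F, Polynomial.finset_sum_coeff, Polynomial.coeff_add, Polynomial.coeff_C_mul,
      Polynomial.coeff_X_pow, mul_ite, mul_one, mul_zero, Polynomial.coeff_zero,
      Finset.sum_add_distrib] at h
    exact h
  obtain ⟨m, hm, hγm⟩ := hγ
  have hξ : ξ₀ = 0 := by
    by_contra hξ
    have key : ∀ n, n ∈ Finset.Icc 1 (k - 1) → γ n = 0 := by
      intro n
      induction n using Nat.strong_induction_on with
      | _ n ih =>
        intro hn
        have h := hc n
        rw [Finset.sum_eq_zero, Finset.sum_ite_eq, if_pos hn, zero_add] at h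
        · rw [Finset.mem_Icc] at hn
          have hne : ((k - n : ℕ) : ℝ) ≠ 0 := by
            rw [Nat.cast_ne_zero]
            omega
          simpa [hξ, hne] using h
        · intro i hi
          split_ifs with hni
          · rw [ih i (by omega) hi]
            ring
          · rfl
    exact hγm (key m hm)
  have hβ : β₀ = 0 := by
    have h := hc (m + ℓ)
    simp only [hξ, zero_mul, ite_self, Finset.sum_const_zero, add_zero,
      Nat.add_right_cancel_iff, Finset.sum_ite_eq, if_pos hm] at h
    rw [Finset.mem_Icc] at hm
    have hne : (m : ℝ) ≠ 0 := by
      rw [Nat.cast_ne_zero]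
      omega
    simpa [hγm, hne] using h
  exact ⟨hξ, hη₀, hη₁, hα₀, hα₁, hβ⟩
end

section
/- Let k > 2 be an integer, ι an integer with 1 ≤ ι ≤ k−1, and S = {y = a + bᶦx^{k−ᶦ}} ⊂ ℝ⁴. For t ∈ ℝ let Ω_t = {(x,y,a,b) ∈ ℝ⁴ : 1 − ty > 0 and 1 − ta > 0} and define Φ_t: Ω_t → ℝ⁴ by Φ_t(x,y,a,b) = ( x·(1−ty)^{−1/(k−ι)}, y/(1−ty), a/(1−ta), b·(1−ta)^{−1/ι} ), where the real powers are taken of the positive numbers 1−ty and 1−ta. Then Φ_t is a para-holomorphic map and Φ_t maps S ∩ Ω_t into S. -/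
/-- for `k > 2`, `1 ≤ ι ≤ k−1`, `t ∈ ℝ`,
`Ω_t = {1 − ty > 0 and 1 − ta > 0}` and
`Φ_t(x,y,a,b) = (x(1−ty)^{−1/(k−ι)}, y/(1−ty), a/(1−ta), b(1−ta)^{−1/ι})`
(real powers of the positive numbers `1−ty`, `1−ta`), the map `Φ_t` is
para-holomorphic and maps `S ∩ Ω_t` into `S`, where
`S = {y = a + bᶥ x^{k-ι}} ⊆ ℝ⁴ = ℝ²_{xy} × ℝ²_{ab}` (coordinates `(x,y,a,b)`). -/
theorem stmt_16
    (k ι : ℕ) (hk : 2 < k) (hι₁ : 1 ≤ ι) (hι₂ : ι ≤ k - 1)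
    (t : ℝ)
    (S Ωt : Set (ℝ × ℝ × ℝ × ℝ))
    (hS : S = {q : ℝ × ℝ × ℝ × ℝ | q.2.1 = q.2.2.1 + q.2.2.2 ^ ι * q.1 ^ (k - ι)})
    (hΩ : Ωt = {q : ℝ × ℝ × ℝ × ℝ | 0 < 1 - t * q.2.1 ∧ 0 < 1 - t * q.2.2.1})
    (Φ : (ℝ × ℝ × ℝ × ℝ) → ℝ × ℝ × ℝ × ℝ)
    (hΦ : Φ = fun q =>
      (q.1 * (1 - t * q.2.1) ^ (-(1 : ℝ) / ((k : ℝ) - (ι : ℝ))),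
       q.2.1 / (1 - t * q.2.1),
       q.2.2.1 / (1 - t * q.2.2.1),
       q.2.2.2 * (1 - t * q.2.2.1) ^ (-(1 : ℝ) / (ι : ℝ)))) :
    -- para-holomorphic: the (x,y)-components depend only on (x,y),
    -- the (a,b)-components only on (a,b)
    (∀ q q' : ℝ × ℝ × ℝ × ℝ, q.1 = q'.1 → q.2.1 = q'.2.1 →
      (Φ q).1 = (Φ q').1 ∧ (Φ q).2.1 = (Φ q').2.1) ∧
    (∀ q q' : ℝ × ℝ × ℝ × ℝ, q.2.2 = q'.2.2 → (Φ q).2.2 = (Φ q').2.2) ∧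
    -- maps S ∩ Ω_t into S
    (∀ q ∈ S ∩ Ωt, Φ q ∈ S) := by
  have key : ∀ (u : ℝ) (n : ℕ), 0 < u → n ≠ 0 → (u ^ (-(1 : ℝ) / (n : ℝ))) ^ n = u⁻¹ := by
    intro u n hu hn
    have hn' : (n : ℝ) ≠ 0 := Nat.cast_ne_zero.mpr hn
    rw [← Real.rpow_natCast, ← Real.rpow_mul hu.le, div_mul_cancel₀ _ hn', Real.rpow_neg_one]
  subst hS hΩ hΦ
  refine ⟨?_, ?_, ?_⟩
  · intro q q' h1 h2
    simp only [h1, h2, and_self]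
  · intro q q' h
    simp only [h]
  · rintro ⟨x, y, a, b⟩ ⟨hq, hy, ha⟩
    simp only [Set.mem_setOf_eq] at hq hy ha ⊢
    have hle : ι ≤ k := by omega
    have hc : (k : ℝ) - (ι : ℝ) = ((k - ι : ℕ) : ℝ) := by
      rw [Nat.cast_sub hle]
    rw [hc, mul_pow, mul_pow, key _ _ hy (by omega), key _ _ ha (by omega)]
    have e : b ^ ι * (1 - t * a)⁻¹ * (x ^ (k - ι) * (1 - t * y)⁻¹)
        = (y - a) * ((1 - t * a)⁻¹ * (1 - t * y)⁻¹) := by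
      rw [show y - a = b ^ ι * x ^ (k - ι) by linarith]
      ring
    rw [e]
    have hy' := hy.ne'
    have ha' := ha.ne'
    rw [div_eq_iff hy', add_mul, mul_assoc, mul_assoc, inv_mul_cancel₀ hy', mul_one,
      div_mul_eq_mul_div, ← div_eq_mul_inv, ← add_div, eq_div_iff ha']
    ring
end

section
/- Fix an integer k > 2 and real numbers γ₁,…,γ_{k−1}, not all zero; let P(x,b) = ∑_{i=1}^{k−1} γᵢ bⁱ x^{k−i} and S = {y = a + P(x,b)} ⊂ ℝ⁴. Assume that the polynomial ∂²P/∂x∂b(x,b), which is homogeneous of degree k−2, is NOT of the form c·(μx + νb)^{k−2} for any real numbers c, μ, ν. Let Φ(x,y,a,b) = (Ξ(x,y), H(x,y), A(a,b), B(a,b)) be a smooth diffeomorphism from an open neighborhood of the origin in ℝ⁴ onto an open subset of ℝ⁴ such that Φ maps S ∩ dom(Φ) onto S ∩ im(Φ). Then Ξ(0,0) = 0, B(0,0) = 0, and H(0,0) = A(0,0). -/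
open Filter Topology Asymptotics

noncomputable def PX (k : ℕ) (γ : ℕ → ℝ) (x b : ℝ) : ℝ :=
  ∑ i ∈ Finset.Icc 1 (k - 1), γ i * b ^ i * (((k - i : ℕ) : ℝ) * x ^ (k - i - 1))

noncomputable def PB (k : ℕ) (γ : ℕ → ℝ) (x b : ℝ) : ℝ :=
  ∑ i ∈ Finset.Icc 1 (k - 1), γ i * ((i : ℝ) * b ^ (i - 1)) * x ^ (k - i)

noncomputable def PQ (k : ℕ) (γ : ℕ → ℝ) (x b : ℝ) : ℝ :=
  ∑ i ∈ Finset.Icc 1 (k - 1),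
    γ i * ((i : ℝ) * b ^ (i - 1)) * (((k - i : ℕ) : ℝ) * x ^ (k - i - 1))

lemma hasDeriv_P_x (k : ℕ) (γ : ℕ → ℝ) (x b : ℝ) :
    HasDerivAt (fun r => Ppoly k γ r b) (PX k γ x b) x := by
  unfold Ppoly PX
  exact HasDerivAt.fun_sum fun i _ => (hasDerivAt_pow (k - i) x).const_mul (γ i * b ^ i)

lemma hasDeriv_P_b (k : ℕ) (γ : ℕ → ℝ) (x b : ℝ) :
    HasDerivAt (fun r => Ppoly k γ x r) (PB k γ x b) b := by
  unfold Ppoly PB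
  exact HasDerivAt.fun_sum fun i _ => ((hasDerivAt_pow i b).const_mul (γ i)).mul_const _

lemma hasDeriv_PX_b (k : ℕ) (γ : ℕ → ℝ) (x b : ℝ) :
    HasDerivAt (fun r => PX k γ x r) (PQ k γ x b) b := by
  unfold PX PQ
  exact HasDerivAt.fun_sum fun i _ => ((hasDerivAt_pow i b).const_mul (γ i)).mul_const _

lemma hasDeriv_PB_x (k : ℕ) (γ : ℕ → ℝ) (x b : ℝ) :
    HasDerivAt (fun r => PB k γ r b) (PQ k γ x b) x := by
  unfold PB PQ
  exact HasDerivAt.fun_sum fun i _ => (hasDerivAt_pow (k - i) x).const_mul _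

lemma cont_P (k : ℕ) (γ : ℕ → ℝ) : Continuous fun p : ℝ × ℝ => Ppoly k γ p.1 p.2 := by
  unfold Ppoly; fun_prop
lemma cont_PX (k : ℕ) (γ : ℕ → ℝ) : Continuous fun p : ℝ × ℝ => PX k γ p.1 p.2 := by
  unfold PX; fun_prop
lemma cont_PB (k : ℕ) (γ : ℕ → ℝ) : Continuous fun p : ℝ × ℝ => PB k γ p.1 p.2 := by
  unfold PB; fun_prop
lemma diff_P (k : ℕ) (γ : ℕ → ℝ) : Differentiable ℝ fun p : ℝ × ℝ => Ppoly k γ p.1 p.2 := by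
  unfold Ppoly; fun_prop

lemma P_b0 (k : ℕ) (γ : ℕ → ℝ) (x : ℝ) : Ppoly k γ x 0 = 0 := by
  unfold Ppoly
  refine Finset.sum_eq_zero fun i hi => ?_
  rw [Finset.mem_Icc] at hi
  rw [zero_pow (by omega)]; ring

lemma P_x0 (k : ℕ) (hk : 2 < k) (γ : ℕ → ℝ) (b : ℝ) : Ppoly k γ 0 b = 0 := by
  unfold Ppoly
  refine Finset.sum_eq_zero fun i hi => ?_
  rw [Finset.mem_Icc] at hi
  rw [zero_pow (by omega)]; ring

lemma PX_00 (k : ℕ) (γ : ℕ → ℝ) (x : ℝ) : PX k γ x 0 = 0 := by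
  unfold PX
  refine Finset.sum_eq_zero fun i hi => ?_
  rw [Finset.mem_Icc] at hi
  rw [zero_pow (by omega)]; ring

lemma PB_00 (k : ℕ) (hk : 2 < k) (γ : ℕ → ℝ) (b : ℝ) : PB k γ 0 b = 0 := by
  unfold PB
  refine Finset.sum_eq_zero fun i hi => ?_
  rw [Finset.mem_Icc] at hi
  rw [zero_pow (by omega)]; ring

lemma PQ_homog (k : ℕ) (γ : ℕ → ℝ) (t x b : ℝ) :
    PQ k γ (t * x) (t * b) = t ^ (k - 2) * PQ k γ x b := by
  unfold PQ
  rw [Finset.mul_sum]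
  refine Finset.sum_congr rfl fun i hi => ?_
  rw [Finset.mem_Icc] at hi
  have : k - 2 = (i - 1) + (k - i - 1) := by omega
  rw [this, pow_add, mul_pow, mul_pow]; ring

/-- a homogeneous polynomial invariant along a line direction at infinity -/
lemma PQ_poly (k : ℕ) (γ : ℕ → ℝ) (u v x0 b0 : ℝ) :
    ∃ p : Polynomial ℝ, ∀ s : ℝ, p.eval s = PQ k γ (u + s * x0) (v + s * b0) := by
  refine ⟨∑ i ∈ Finset.Icc 1 (k - 1),
    Polynomial.C (γ i) * (Polynomial.C (i : ℝ) *
      (Polynomial.C v + Polynomial.X * Polynomial.C b0) ^ (i - 1)) *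
      (Polynomial.C ((k - i : ℕ) : ℝ) *
      (Polynomial.C u + Polynomial.X * Polynomial.C x0) ^ (k - i - 1)), fun s => ?_⟩
  simp only [Polynomial.eval_finsetSum, Polynomial.eval_mul, Polynomial.eval_C,
    Polynomial.eval_pow, Polynomial.eval_add, Polynomial.eval_X, PQ]

lemma PQ_isBigO (k : ℕ) (γ : ℕ → ℝ) (f g : ℝ → ℝ)
    (hf : f =O[𝓝 0] fun t => t) (hg : g =O[𝓝 0] fun t => t) :
    (fun t => PQ k γ (f t) (g t)) =O[𝓝 0] fun t => t ^ (k - 2) := by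
  unfold PQ
  refine IsBigO.fun_sum fun i hi => ?_
  rw [Finset.mem_Icc] at hi
  have : k - 2 = (i - 1) + (k - i - 1) := by omega
  simp only [this, pow_add]
  exact (((hg.pow (i-1)).const_mul_left _).const_mul_left _).mul
    ((hf.pow (k-i-1)).const_mul_left _)

lemma PQ_inv (k : ℕ) (γ : ℕ → ℝ) (u v x0 b0 : ℝ)
    (h : (fun t => PQ k γ (x0 + t * u) (b0 + t * v)) =O[𝓝 0] fun t => t ^ (k - 2)) (s : ℝ) :
    PQ k γ (u + s * x0) (v + s * b0) = PQ k γ u v := by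
  obtain ⟨p, hp⟩ := PQ_poly k γ u v x0 b0
  have hdeg : p.degree ≤ 0 := by
    rw [← Polynomial.isBoundedUnder_abs_atTop_iff]
    obtain ⟨C, hC⟩ := h.bound
    refine ⟨C, ?_⟩
    rw [eventually_map]
    filter_upwards [tendsto_inv_atTop_zero.eventually hC, eventually_gt_atTop 0] with r hr hr0
    rw [hp]
    have h1 : PQ k γ (x0 + r⁻¹ * u) (b0 + r⁻¹ * v)
        = (r⁻¹) ^ (k - 2) * PQ k γ (u + r * x0) (v + r * b0) := by
      rw [← PQ_homog]; congr 1 <;> field_simp <;> ring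
    rw [h1, norm_mul, mul_comm] at hr
    have : 0 < ‖(r⁻¹) ^ (k - 2)‖ := norm_pos_iff.2 (by positivity)
    exact le_of_mul_le_mul_right hr this
  rw [Polynomial.degree_le_zero_iff] at hdeg
  have h0 := hp 0
  have hs := hp s
  rw [hdeg, Polynomial.eval_C] at h0 hs
  rw [← hs, h0]; simp

lemma PQ_form (k : ℕ) (γ : ℕ → ℝ) (x0 b0 : ℝ) (h0 : ¬ (x0 = 0 ∧ b0 = 0))
    (h : ∀ u v s, PQ k γ (u + s * x0) (v + s * b0) = PQ k γ u v) :
    ∃ c μ ν : ℝ, ∀ x b, PQ k γ x b = c * (μ * x + ν * b) ^ (k - 2) := by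
  by_cases hx : x0 = 0
  · have hb : b0 ≠ 0 := fun hb => h0 ⟨hx, hb⟩
    refine ⟨PQ k γ 1 0, 1, 0, fun x b => ?_⟩
    rw [← h x b (- b / b0), mul_comm (PQ k γ 1 0), one_mul, zero_mul, add_zero, ← PQ_homog, hx]
    congr 1
    · ring
    · field_simp; ring
  · refine ⟨PQ k γ 0 1, -b0 / x0, 1, fun x b => ?_⟩
    rw [← h x b (- x / x0), mul_comm (PQ k γ 0 1), ← PQ_homog]
    congr 1 <;> field_simp <;> ring

lemma hasDeriv_comp2 {F : ℝ × ℝ → ℝ} {f g : ℝ → ℝ} {f' g' t : ℝ}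
    (hF : DifferentiableAt ℝ F (f t, g t)) (hf : HasDerivAt f f' t) (hg : HasDerivAt g g' t) :
    HasDerivAt (fun r => F (f r, g r))
      (fderiv ℝ F (f t, g t) (1, 0) * f' + fderiv ℝ F (f t, g t) (0, 1) * g') t := by
  have := hF.hasFDerivAt.comp_hasDerivAt t (hf.prodMk hg)
  have e : ((f', g') : ℝ × ℝ) = f' • (1, 0) + g' • (0, 1) := by simp
  rw [e, map_add, map_smul, map_smul, smul_eq_mul, smul_eq_mul, mul_comm f', mul_comm g'] at this
  exact this

/-- transformation rule of the Levi form -/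
lemma levi (k : ℕ) (hk : 2 < k) (γ : ℕ → ℝ) (D : Set (ℝ × ℝ × ℝ × ℝ)) (hD : IsOpen D)
    (hD0 : (0, 0, 0, 0) ∈ D) (Ξ H A B : ℝ × ℝ → ℝ)
    (hΞ : ContDiffAt ℝ 2 Ξ (0, 0)) (hA : ContDiffAt ℝ 2 A (0, 0)) (hB : ContDiffAt ℝ 2 B (0, 0))
    (hid : ∀ x y a b, (x, y, a, b) ∈ D → y = a + Ppoly k γ x b →
      H (x, y) = A (a, b) + Ppoly k γ (Ξ (x, y)) (B (a, b)))
    (hΞx : fderiv ℝ Ξ (0, 0) (1, 0) ≠ 0) (hBb : fderiv ℝ B (0, 0) (0, 1) ≠ 0) :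
    ∃ (R : ℝ × ℝ × ℝ → ℝ) (l : ℝ), Tendsto R (𝓝 (0, 0, 0)) (𝓝 l) ∧
      ∀ᶠ q : ℝ × ℝ × ℝ in 𝓝 (0, 0, 0),
        PQ k γ (Ξ (q.1, q.2.1 + Ppoly k γ q.1 q.2.2)) (B (q.2.1, q.2.2))
          = PQ k γ q.1 q.2.2 * R q := by
  have cP := cont_P k γ
  have cPX := cont_PX k γ
  have cPB := cont_PB k γ
  have ev1 : ∀ {F : ℝ × ℝ → ℝ}, ContDiffAt ℝ 2 F (0, 0) →
      ∀ᶠ p in 𝓝 ((0 : ℝ), (0 : ℝ)), DifferentiableAt ℝ F p := fun hF => by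
    filter_upwards [hF.eventually (by simp)] with p hp
    exact hp.differentiableAt (by simp)
  have cf : ∀ {F : ℝ × ℝ → ℝ}, ContDiffAt ℝ 2 F (0, 0) → ∀ v,
      ContinuousAt (fun p => fderiv ℝ F p v) (0, 0) := fun hF v => by
    have h1 : ContDiffAt ℝ 1 (fderiv ℝ _) _ := hF.fderiv_right (by norm_num)
    exact h1.continuousAt.clm_apply continuousAt_const
  -- two continuous maps
  have m1 : Tendsto (fun q : ℝ × ℝ × ℝ => (q.1, q.2.1 + Ppoly k γ q.1 q.2.2)) (𝓝 (0, 0, 0))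
      (𝓝 (0, 0)) := by
    have : Continuous (fun q : ℝ × ℝ × ℝ => (q.1, q.2.1 + Ppoly k γ q.1 q.2.2)) :=
      continuous_fst.prodMk (continuous_snd.fst.add
        (cP.comp (continuous_fst.prodMk continuous_snd.snd)))
    have h := this.tendsto (0, 0, 0)
    simpa [P_b0] using h
  have m2 : Tendsto (fun q : ℝ × ℝ × ℝ => (q.2.1, q.2.2)) (𝓝 (0, 0, 0)) (𝓝 (0, 0)) :=
    (continuous_snd.fst.prodMk continuous_snd.snd).tendsto (0, 0, 0)
  have m3 : Tendsto (fun q : ℝ × ℝ × ℝ => (q.1, q.2.2)) (𝓝 (0, 0, 0)) (𝓝 (0, 0)) :=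
    (continuous_fst.prodMk continuous_snd.snd).tendsto (0, 0, 0)
  have m4 : Tendsto (fun q : ℝ × ℝ × ℝ => (q.1, q.2.1 + Ppoly k γ q.1 q.2.2, q.2.1, q.2.2))
      (𝓝 (0, 0, 0)) (𝓝 (0, 0, 0, 0)) := by
    have : Continuous (fun q : ℝ × ℝ × ℝ => (q.1, q.2.1 + Ppoly k γ q.1 q.2.2, q.2.1, q.2.2)) :=
      continuous_fst.prodMk ((continuous_snd.fst.add
        (cP.comp (continuous_fst.prodMk continuous_snd.snd))).prodMk
        (continuous_snd.fst.prodMk continuous_snd.snd))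
    have h := this.tendsto (0, 0, 0)
    simpa [P_b0] using h
  -- first identity
  have E1 : ∀ᶠ q : ℝ × ℝ × ℝ in 𝓝 (0, 0, 0),
      -(fderiv ℝ A (q.2.1, q.2.2) (1, 0) * PB k γ q.1 q.2.2) + fderiv ℝ A (q.2.1, q.2.2) (0, 1)
      + PB k γ (Ξ (q.1, q.2.1 + Ppoly k γ q.1 q.2.2)) (B (q.2.1, q.2.2)) *
       (-(fderiv ℝ B (q.2.1, q.2.2) (1, 0) * PB k γ q.1 q.2.2)
         + fderiv ℝ B (q.2.1, q.2.2) (0, 1)) = 0 := by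
    filter_upwards [m4.eventually (hD.mem_nhds hD0), m2.eventually (ev1 hA),
      m2.eventually (ev1 hB)] with q hqD hqA hqB
    obtain ⟨x, a, b⟩ := q
    simp only at hqD hqA hqB ⊢
    set y := a + Ppoly k γ x b with hy
    have hay : y - Ppoly k γ x b = a := by rw [hy]; ring
    have h1 : HasDerivAt (fun t => y - Ppoly k γ x t) (-PB k γ x b) b :=
      (hasDeriv_P_b k γ x b).const_sub y
    have h2 := hasDerivAt_id b
    have dA := hasDeriv_comp2 (F := A) (f := fun t => y - Ppoly k γ x t) (g := id) (t := b)
      (by simpa [hay] using hqA) h1 h2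
    have dB := hasDeriv_comp2 (F := B) (f := fun t => y - Ppoly k γ x t) (g := id) (t := b)
      (by simpa [hay] using hqB) h1 h2
    have dP := (hasDeriv_P_b k γ (Ξ (x, y)) (B (y - Ppoly k γ x b, id b))).comp b dB
    have dS := dA.add dP
    have hc : Continuous fun t => (x, y, y - Ppoly k γ x t, t) := by
      have : Continuous fun t => Ppoly k γ x t := cP.comp (continuous_const.prodMk continuous_id)
      fun_prop
    have hev : ∀ᶠ t in 𝓝 b, (x, y, y - Ppoly k γ x t, t) ∈ D :=
      hc.continuousAt.eventually_mem (hD.mem_nhds (by rw [hay]; exact hqD))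
    have dS0 : HasDerivAt (fun _ : ℝ => H (x, y)) 0 b := hasDerivAt_const _ _
    have := dS0.congr_of_eventuallyEq (f := _) (EventuallyEq.symm (by
      filter_upwards [hev] with t ht
      exact hid x y _ t ht (by ring)))
    have := dS.unique this
    simp only [hay, id] at this
    linarith
  -- second identity
  have E2 : ∀ᶠ q : ℝ × ℝ × ℝ in 𝓝 (0, 0, 0),
      PQ k γ q.1 q.2.2 * (fderiv ℝ A (q.2.1, q.2.2) (1, 0) +
        PB k γ (Ξ (q.1, q.2.1 + Ppoly k γ q.1 q.2.2)) (B (q.2.1, q.2.2)) *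
          fderiv ℝ B (q.2.1, q.2.2) (1, 0))
      = PQ k γ (Ξ (q.1, q.2.1 + Ppoly k γ q.1 q.2.2)) (B (q.2.1, q.2.2)) *
        ((fderiv ℝ Ξ (q.1, q.2.1 + Ppoly k γ q.1 q.2.2) (1, 0)
          + fderiv ℝ Ξ (q.1, q.2.1 + Ppoly k γ q.1 q.2.2) (0, 1) * PX k γ q.1 q.2.2) *
         (-(fderiv ℝ B (q.2.1, q.2.2) (1, 0) * PB k γ q.1 q.2.2)
         + fderiv ℝ B (q.2.1, q.2.2) (0, 1))) := by
    filter_upwards [E1.eventually_nhds, m1.eventually (ev1 hΞ)] with q hq hqX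
    obtain ⟨x, a, b⟩ := q
    simp only at hqX ⊢
    have hc : Continuous fun r : ℝ => (r, a, b) := by fun_prop
    have hq' := (hc.tendsto x).eventually hq
    simp only at hq'
    have dX := hasDeriv_comp2 (F := Ξ) (f := id) (g := fun r => a + Ppoly k γ r b) (t := x)
      hqX (hasDerivAt_id x) ((hasDeriv_P_x k γ x b).const_add a)
    have dPB := hasDeriv_PB_x k γ x b
    have dP := (hasDeriv_PB_x k γ (Ξ (id x, a + Ppoly k γ x b)) (B (a, b))).comp x dX
    have dS := (((dPB.const_mul (fderiv ℝ A (a, b) (1, 0))).neg.add_const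
      (fderiv ℝ A (a, b) (0, 1))).add (dP.mul
        ((dPB.const_mul (fderiv ℝ B (a, b) (1, 0))).neg.add_const (fderiv ℝ B (a, b) (0, 1)))))
    have d0 : HasDerivAt (fun _ : ℝ => (0 : ℝ)) 0 x := hasDerivAt_const _ _
    have := dS.unique (d0.congr_of_eventuallyEq hq')
    simp only [id, Function.comp, Pi.neg_apply] at this
    linarith
  -- continuity
  have c1 : ∀ v, Tendsto (fun q : ℝ × ℝ × ℝ => fderiv ℝ A (q.2.1, q.2.2) v) (𝓝 (0, 0, 0))
      (𝓝 (fderiv ℝ A (0, 0) v)) := fun v => (cf hA v).tendsto.comp m2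
  have c2 : ∀ v, Tendsto (fun q : ℝ × ℝ × ℝ => fderiv ℝ B (q.2.1, q.2.2) v) (𝓝 (0, 0, 0))
      (𝓝 (fderiv ℝ B (0, 0) v)) := fun v => (cf hB v).tendsto.comp m2
  have c3 : ∀ v, Tendsto (fun q : ℝ × ℝ × ℝ =>
      fderiv ℝ Ξ (q.1, q.2.1 + Ppoly k γ q.1 q.2.2) v) (𝓝 (0, 0, 0))
      (𝓝 (fderiv ℝ Ξ (0, 0) v)) := fun v => (cf hΞ v).tendsto.comp m1
  have c4 : Tendsto (fun q : ℝ × ℝ × ℝ => PB k γ q.1 q.2.2) (𝓝 (0, 0, 0)) (𝓝 0) := by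
    have := (cPB.tendsto (0, 0)).comp m3
    simpa [PB_00 k hk, Function.comp_def] using this
  have c5 : Tendsto (fun q : ℝ × ℝ × ℝ => PX k γ q.1 q.2.2) (𝓝 (0, 0, 0)) (𝓝 0) := by
    have := (cPX.tendsto (0, 0)).comp m3
    simpa [PX_00, Function.comp_def] using this
  have c6 : Tendsto (fun q : ℝ × ℝ × ℝ =>
      PB k γ (Ξ (q.1, q.2.1 + Ppoly k γ q.1 q.2.2)) (B (q.2.1, q.2.2))) (𝓝 (0, 0, 0))
      (𝓝 (PB k γ (Ξ (0, 0)) (B (0, 0)))) := by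
    have t1 : Tendsto (fun q : ℝ × ℝ × ℝ => Ξ (q.1, q.2.1 + Ppoly k γ q.1 q.2.2)) (𝓝 (0, 0, 0))
      (𝓝 (Ξ (0, 0))) := hΞ.continuousAt.tendsto.comp m1
    have t2 : Tendsto (fun q : ℝ × ℝ × ℝ => B (q.2.1, q.2.2)) (𝓝 (0, 0, 0))
      (𝓝 (B (0, 0))) := hB.continuousAt.tendsto.comp m2
    have t3 : Tendsto (fun p : ℝ × ℝ => PB k γ p.1 p.2) (𝓝 (Ξ (0, 0), B (0, 0)))
      (𝓝 (PB k γ (Ξ (0, 0)) (B (0, 0)))) := cPB.tendsto _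
    have t4 := t1.prodMk_nhds t2
    have t5 := t3.comp t4
    simpa only [Function.comp_def] using t5
  have cU := ((c3 (1, 0)).add ((c3 (0, 1)).mul c5)).mul ((((c2 (1, 0)).mul c4).neg).add (c2 (0, 1)))
  have cV := (c1 (1, 0)).add (c6.mul (c2 (1, 0)))
  have hU0 : (fderiv ℝ Ξ (0, 0) (1, 0) + fderiv ℝ Ξ (0, 0) (0, 1) * 0) *
      (-(fderiv ℝ B (0, 0) (1, 0) * 0) + fderiv ℝ B (0, 0) (0, 1)) ≠ 0 := by
    simpa using ⟨hΞx, hBb⟩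
  have cR := cV.div cU hU0
  refine ⟨_, _, cR, ?_⟩
  filter_upwards [E2, cU.eventually_ne hU0] with q h1 h2
  rw [Pi.div_apply, ← mul_div_assoc, eq_div_iff h2]
  exact h1.symm

/-- let `k > 2`, `γᵢ` not all zero, `S = {y = a + P(x,b)}` in
`ℝ⁴ = ℝ²_{xy} × ℝ²_{ab}` (coordinates `(x,y,a,b)`), and assume the homogeneous
degree `k−2` polynomial `∂²P/∂x∂b` is not of the form `c(μx + νb)^{k−2}`.  Then
every multicontact automorphism of `S` defined near the origin, i.e. every
smooth diffeomorphism `Φ = (Ξ(x,y), H(x,y), A(a,b), B(a,b))` of split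
(para-holomorphic) form mapping `S ∩ dom Φ` onto `S ∩ im Φ`, satisfies
`Ξ(0,0) = 0`, `B(0,0) = 0` and `H(0,0) = A(0,0)`. -/
theorem stmt_17
    (k : ℕ) (hk : 2 < k) (γ : ℕ → ℝ)
    (hγ : ∃ i ∈ Finset.Icc 1 (k - 1), γ i ≠ 0)
    (hPxb : ¬ ∃ c μ ν : ℝ, ∀ x b : ℝ,
      deriv (fun s => deriv (fun r => Ppoly k γ r s) x) b
        = c * (μ * x + ν * b) ^ (k - 2))
    (S : Set (ℝ × ℝ × ℝ × ℝ))
    (hS : S = {q : ℝ × ℝ × ℝ × ℝ | q.2.1 = q.2.2.1 + Ppoly k γ q.1 q.2.2.2})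
    (D : Set (ℝ × ℝ × ℝ × ℝ)) (hD : IsOpen D) (hD0 : (0 : ℝ × ℝ × ℝ × ℝ) ∈ D)
    (Ξ H A B : ℝ × ℝ → ℝ)
    (Φ : (ℝ × ℝ × ℝ × ℝ) → ℝ × ℝ × ℝ × ℝ)
    (hΦ : Φ = fun q => (Ξ (q.1, q.2.1), H (q.1, q.2.1),
      A (q.2.2.1, q.2.2.2), B (q.2.2.1, q.2.2.2)))
    (hsm : ContDiffOn ℝ (⊤ : ℕ∞) Φ D) (hinj : Set.InjOn Φ D)
    (hopen : IsOpen (Φ '' D))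
    (hdiffeo : ∃ Φinv : (ℝ × ℝ × ℝ × ℝ) → ℝ × ℝ × ℝ × ℝ,
      ContDiffOn ℝ (⊤ : ℕ∞) Φinv (Φ '' D) ∧ ∀ q ∈ D, Φinv (Φ q) = q)
    (hmaps : Φ '' (S ∩ D) = S ∩ Φ '' D) :
    Ξ (0, 0) = 0 ∧ B (0, 0) = 0 ∧ H (0, 0) = A (0, 0) := by
  have hΦ0 : ∀ x y a b, Φ (x, y, a, b) = (Ξ (x, y), H (x, y), A (a, b), B (a, b)) := by
    intro x y a b; rw [hΦ]
  have hD0' : ((0 : ℝ), (0 : ℝ), (0 : ℝ), (0 : ℝ)) ∈ D := hD0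
  have hid : ∀ x y a b, (x, y, a, b) ∈ D → y = a + Ppoly k γ x b →
      H (x, y) = A (a, b) + Ppoly k γ (Ξ (x, y)) (B (a, b)) := by
    intro x y a b hm hy
    have hm' : Φ (x, y, a, b) ∈ S ∩ Φ '' D := by
      rw [← hmaps]; exact ⟨_, ⟨by rw [hS]; exact hy, hm⟩, rfl⟩
    have := hm'.1
    rw [hS, hΦ0] at this
    exact this
  obtain ⟨Φinv, hinv, hinvΦ⟩ := hdiffeo
  have hcd : ContDiffAt ℝ (⊤ : ℕ∞) Φ (0, 0, 0, 0) := hsm.contDiffAt (hD.mem_nhds hD0')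
  have hcd2 : ContDiffAt ℝ 2 Φ (0, 0, 0, 0) := hcd.of_le (by
    have : ((2 : ℕ∞) : WithTop ℕ∞) ≤ ((⊤ : ℕ∞) : WithTop ℕ∞) := WithTop.coe_le_coe.2 le_top
    exact this)
  have i1 : ContDiffAt ℝ 2 (fun p : ℝ × ℝ => Φ (p.1, p.2, 0, 0)) (0, 0) :=
    hcd2.comp ((0 : ℝ), (0 : ℝ)) (f := fun p : ℝ × ℝ => (p.1, p.2, (0 : ℝ), (0 : ℝ)))
      (by fun_prop)
  have i2 : ContDiffAt ℝ 2 (fun p : ℝ × ℝ => Φ (0, 0, p.1, p.2)) (0, 0) :=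
    hcd2.comp ((0 : ℝ), (0 : ℝ)) (f := fun p : ℝ × ℝ => ((0 : ℝ), (0 : ℝ), p.1, p.2))
      (by fun_prop)
  simp only [hΦ0] at i1 i2
  have hΞ : ContDiffAt ℝ 2 Ξ (0, 0) := i1.fst
  have hH : ContDiffAt ℝ 2 H (0, 0) := i1.snd.fst
  have hA : ContDiffAt ℝ 2 A (0, 0) := i2.snd.snd.fst
  have hB : ContDiffAt ℝ 2 B (0, 0) := i2.snd.snd.snd
  have hinvat : DifferentiableAt ℝ Φinv (Φ (0, 0, 0, 0)) :=
    (hinv.contDiffAt (hopen.mem_nhds ⟨_, hD0', rfl⟩)).differentiableAt (by simp)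
  have hHA : H (0, 0) = A (0, 0) + Ppoly k γ (Ξ (0, 0)) (B (0, 0)) :=
    hid 0 0 0 0 hD0' (by simp [P_b0])
  have hid0 : HasDerivAt (fun r : ℝ => r) 1 0 := hasDerivAt_id 0
  have hc0 : HasDerivAt (fun _ : ℝ => (0 : ℝ)) 0 0 := hasDerivAt_const _ _
  -- nonvanishing of the derivatives
  have hΞx : fderiv ℝ Ξ (0, 0) (1, 0) ≠ 0 := by
    intro h0
    have dX := hasDeriv_comp2 (F := Ξ) (f := fun r => r) (g := fun _ => 0) (t := 0)
      (hΞ.differentiableAt (by simp)) hid0 hc0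
    simp only [h0, zero_mul, mul_zero, add_zero] at dX
    have hev : ∀ᶠ r in 𝓝 (0 : ℝ), (r, (0 : ℝ), (0 : ℝ), (0 : ℝ)) ∈ D :=
      (show Continuous fun r : ℝ => (r, (0 : ℝ), (0 : ℝ), (0 : ℝ)) by
        fun_prop).continuousAt.eventually_mem (hD.mem_nhds hD0')
    have dP := ((hasDeriv_P_x k γ (Ξ (0, 0)) (B (0, 0))).comp (0 : ℝ) (h := fun r : ℝ => Ξ (r, 0)) dX).const_add (A (0, 0))
    have dH : HasDerivAt (fun r => H (r, 0)) 0 0 := by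
      rw [mul_zero] at dP
      refine dP.congr_of_eventuallyEq ?_
      filter_upwards [hev] with r hr
      exact hid r 0 0 0 hr (by simp [P_b0])
    have dΦ : HasDerivAt (fun r => Φ (r, 0, 0, 0)) (0, 0, 0, 0) 0 := by
      simp only [hΦ0]
      exact dX.prodMk (dH.prodMk ((hasDerivAt_const _ _).prodMk (hasDerivAt_const _ _)))
    have dI := (hinvat.hasFDerivAt.comp_hasDerivAt (0 : ℝ) dΦ)
    have dI2 := (dI.congr_of_eventuallyEq (f₁ := fun r => (r, (0 : ℝ), (0 : ℝ), (0 : ℝ))) (by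
      filter_upwards [hev] with r hr
      exact (hinvΦ _ hr).symm))
    have := dI2.unique (hid0.prodMk (hc0.prodMk (hc0.prodMk hc0)))
    have z : ((0, 0, 0, 0) : ℝ × ℝ × ℝ × ℝ) = 0 := rfl
    rw [z, map_zero] at this
    have := congrArg (fun w : ℝ × ℝ × ℝ × ℝ => w.1) this
    simp at this
  have hBb : fderiv ℝ B (0, 0) (0, 1) ≠ 0 := by
    intro h0
    have dX := hasDeriv_comp2 (F := B) (f := fun _ => 0) (g := fun r => r) (t := 0)
      (hB.differentiableAt (by simp)) hc0 hid0
    simp only [h0, zero_mul, mul_zero, add_zero] at dX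
    have hev : ∀ᶠ r in 𝓝 (0 : ℝ), ((0 : ℝ), (0 : ℝ), (0 : ℝ), r) ∈ D :=
      (show Continuous fun r : ℝ => ((0 : ℝ), (0 : ℝ), (0 : ℝ), r) by
        fun_prop).continuousAt.eventually_mem (hD.mem_nhds hD0')
    have dP := ((hasDeriv_P_b k γ (Ξ (0, 0)) (B (0, 0))).comp (0 : ℝ) (h := fun r : ℝ => B (0, r)) dX).const_sub (H (0, 0))
    have dA : HasDerivAt (fun r => A (0, r)) 0 0 := by
      rw [mul_zero, neg_zero] at dP
      refine dP.congr_of_eventuallyEq ?_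
      filter_upwards [hev] with r hr
      have := hid 0 0 0 r hr (by simp [P_x0 k hk])
      simp only [Function.comp]
      linarith
    have dΦ : HasDerivAt (fun r => Φ (0, 0, 0, r)) (0, 0, 0, 0) 0 := by
      simp only [hΦ0]
      exact (hasDerivAt_const _ _).prodMk ((hasDerivAt_const _ _).prodMk (dA.prodMk dX))
    have dI := (hinvat.hasFDerivAt.comp_hasDerivAt (0 : ℝ) dΦ)
    have dI2 := (dI.congr_of_eventuallyEq (f₁ := fun r => ((0 : ℝ), (0 : ℝ), (0 : ℝ), r)) (by
      filter_upwards [hev] with r hr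
      exact (hinvΦ _ hr).symm))
    have := dI2.unique (hc0.prodMk (hc0.prodMk (hc0.prodMk hid0)))
    have z : ((0, 0, 0, 0) : ℝ × ℝ × ℝ × ℝ) = 0 := rfl
    rw [z, map_zero] at this
    have := congrArg (fun w : ℝ × ℝ × ℝ × ℝ => w.2.2.2) this
    simp at this
  obtain ⟨R, l, hR, hRQ⟩ := levi k hk γ D hD hD0' Ξ H A B hΞ hA hB hid hΞx hBb
  -- it suffices to show that the image of the origin has vanishing coordinates
  by_cases hz : Ξ (0, 0) = 0 ∧ B (0, 0) = 0
  · exact ⟨hz.1, hz.2, by rw [hHA, hz.2, P_b0, add_zero]⟩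
  exfalso
  apply hPxb
  have hder : ∀ x b, deriv (fun s => deriv (fun r => Ppoly k γ r s) x) b = PQ k γ x b := by
    intro x b
    have : (fun s => deriv (fun r => Ppoly k γ r s) x) = fun s => PX k γ x s := by
      funext s; exact (hasDeriv_P_x k γ x s).deriv
    rw [this]; exact (hasDeriv_PX_b k γ x b).deriv
  simp only [hder]
  refine PQ_form k γ (Ξ (0, 0)) (B (0, 0)) hz fun u v s => PQ_inv k γ u v _ _ ?_ s
  -- the curve in the image
  set c : ℝ → ℝ × ℝ × ℝ × ℝ := fun t => (Ξ (0, 0) + t * u,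
    A (0, 0) + Ppoly k γ (Ξ (0, 0) + t * u) (B (0, 0) + t * v), A (0, 0), B (0, 0) + t * v) with hc
  have hcdiff : Differentiable ℝ c := by
    have h1 : Differentiable ℝ fun t : ℝ => Ppoly k γ (Ξ (0, 0) + t * u) (B (0, 0) + t * v) :=
      (diff_P k γ).comp (f := fun t : ℝ => (Ξ (0, 0) + t * u, B (0, 0) + t * v)) (by fun_prop)
    rw [hc]; fun_prop
  have hc00 : c 0 = Φ (0, 0, 0, 0) := by
    rw [hΦ0, hHA]; simp [hc]
  have hqd : DifferentiableAt ℝ (fun t => Φinv (c t)) 0 := by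
    have : DifferentiableAt ℝ Φinv (c 0) := by rw [hc00]; exact hinvat
    exact this.comp 0 (hcdiff 0)
  have hq0 : Φinv (c 0) = (0, 0, 0, 0) := by rw [hc00, hinvΦ _ hD0']
  have hO : ∀ f : ℝ → ℝ, DifferentiableAt ℝ f 0 → f 0 = 0 → f =O[𝓝 0] fun t => t := by
    intro f hf h0
    have := hf.isBigO_sub
    simpa [h0] using this
  have O1 := hO (fun t => (Φinv (c t)).1) hqd.fst (by simp [hq0])
  have O2 := hO (fun t => (Φinv (c t)).2.2.2) hqd.snd.snd.snd (by simp [hq0])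
  have OQ := PQ_isBigO k γ _ _ O1 O2
  have ht : Tendsto (fun t => ((Φinv (c t)).1, (Φinv (c t)).2.2.1, (Φinv (c t)).2.2.2)) (𝓝 0)
      (𝓝 (0, 0, 0)) := by
    have h := (hqd.fst.prodMk (hqd.snd.snd.fst.prodMk hqd.snd.snd.snd)).continuousAt.tendsto
    simpa only [hq0] using h
  have OR : (fun t => R ((Φinv (c t)).1, (Φinv (c t)).2.2.1, (Φinv (c t)).2.2.2)) =O[𝓝 0]
      fun _ => (1 : ℝ) := (hR.comp ht).isBigO_one ℝ
  have Otot := OQ.mul OR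
  simp only [mul_one] at Otot
  refine Otot.congr' ?_ EventuallyEq.rfl
  have hcim : ∀ᶠ t in 𝓝 (0 : ℝ), c t ∈ Φ '' D :=
    hcdiff.continuous.continuousAt.eventually_mem
      (hopen.mem_nhds (by rw [hc00]; exact ⟨_, hD0', rfl⟩))
  filter_upwards [hcim, ht.eventually hRQ] with t h1 h2
  have h3 : c t ∈ Φ '' (S ∩ D) := by
    rw [hmaps]; exact ⟨by rw [hS]; simp [hc], h1⟩
  obtain ⟨⟨x, y, a, b⟩, ⟨hqS, hqD⟩, hq⟩ := h3
  rw [hS] at hqS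
  have hqS' : y = a + Ppoly k γ x b := hqS
  have hi : Φinv (c t) = (x, y, a, b) := by rw [← hq, hinvΦ _ hqD]
  simp only [hi] at h2 ⊢
  rw [← h2, ← hqS']
  rw [hΦ0] at hq
  simp only [hc, Prod.mk.injEq] at hq
  rw [hq.1, hq.2.2.2]
end

section
/- Fix an integer k > 2 and real numbers γ₁,…,γ_{k−1}, not all zero, such that γᵢ ≠ 0 for at least one index i ≥ 2 and for at least one index i ≤ k−2. Let P(x,b) = ∑_{i=1}^{k−1} γᵢ bⁱ x^{k−i} and S = {y = a + P(x,b)} ⊂ ℝ⁴. Let Φ(x,y,a,b) = (Ξ(x,y), H(x,y), A(a,b), B(a,b)) be a smooth diffeomorphism from a neighborhood of the origin in ℝ⁴ onto its image with Φ(0) = 0 and Φ(S ∩ dom(Φ)) ⊆ S. Then the differential of Φ at the origin is diagonal in the coordinates (x,y,a,b): writing t = ∂Ξ/∂x(0), s = ∂B/∂b(0), one has ∂Ξ/∂y(0) = ∂H/∂x(0) = ∂A/∂b(0) = ∂B/∂a(0) = 0 and ∂H/∂y(0) = ∂A/∂a(0) = τ, where moreover τ = sⁱ·t^{k−i} for every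 index i with γᵢ ≠ 0. -/
/-- chain rule along a plane curve -/
theorem curve_deriv {f : ℝ × ℝ → ℝ} {α β : ℝ → ℝ} {h α' β' : ℝ}
    (hf : DifferentiableAt ℝ f (α h, β h)) (hα : HasDerivAt α α' h) (hβ : HasDerivAt β β' h) :
    HasDerivAt (fun r => f (α r, β r))
      (fderiv ℝ f (α h, β h) (1, 0) * α' + fderiv ℝ f (α h, β h) (0, 1) * β') h := by
  have h1 := HasFDerivAt.comp_hasDerivAt h (f := fun r => (α r, β r)) hf.hasFDerivAt (hα.prodMk hβ)
  refine h1.congr_deriv ?_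
  have : ((α', β') : ℝ × ℝ) = α' • ((1, 0) : ℝ × ℝ) + β' • ((0, 1) : ℝ × ℝ) := by
    ext <;> simp
  rw [this, map_add, map_smul, map_smul]
  simp [mul_comm]

theorem coeff_zero {n : ℕ} {e : ℕ → ℝ} (h : ∀ Y : ℝ, ∑ j ∈ Finset.range (n + 1), e j * Y ^ j = 0) :
    ∀ j ≤ n, e j = 0 := by
  intro j hj
  have hp : (∑ j ∈ Finset.range (n + 1), Polynomial.C (e j) * Polynomial.X ^ j : Polynomial ℝ) = 0 := by
    apply Polynomial.funext
    intro r
    simpa [Polynomial.eval_finsetSum] using h r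
  have := congrArg (fun p => Polynomial.coeff p j) hp
  simp [Polynomial.coeff_X_pow] at this
  exact this (by omega)

/-- the mixed partial derivative of `P`, re-indexed -/
def Qp (n : ℕ) (d : ℕ → ℝ) (x b : ℝ) : ℝ := ∑ j ∈ Finset.range (n + 1), d j * b ^ j * x ^ (n - j)

theorem Qp_scale (n : ℕ) (d : ℕ → ℝ) (x b e : ℝ) : Qp n d (e * x) (e * b) = e ^ n * Qp n d x b := by
  unfold Qp
  rw [Finset.mul_sum]
  refine Finset.sum_congr rfl fun j hj => ?_
  have : j ≤ n := by simpa [Nat.lt_succ_iff] using hj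
  have h2 : e ^ n = e ^ j * e ^ (n - j) := by rw [← pow_add]; congr 1; omega
  rw [h2]; ring

theorem Qp_left_zero (n : ℕ) (d : ℕ → ℝ) (b : ℝ) : Qp n d 0 b = d n * b ^ n := by
  unfold Qp
  rw [Finset.sum_eq_single n]
  · simp
  · intro j hj hne
    have : j < n := by simp at hj; omega
    rw [zero_pow (by omega)]; ring
  · simp

theorem Qp_right_zero (n : ℕ) (d : ℕ → ℝ) (x : ℝ) : Qp n d x 0 = d 0 * x ^ n := by
  unfold Qp
  rw [Finset.sum_eq_single 0]
  · simp
  · intro j hj hne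
    rw [zero_pow hne]; ring
  · simp

theorem Qp_one (n : ℕ) (d : ℕ → ℝ) (b : ℝ) :
    Qp n d 1 b = ∑ j ∈ Finset.range (n + 1), d j * b ^ j := by
  simp [Qp]

theorem Qp_coeff {n : ℕ} {d : ℕ → ℝ} {τ m s t : ℝ}
    (h : ∀ x b, Qp n d x b * τ = Qp n d (t * x) (s * b) * m) :
    ∀ j ≤ n, d j * τ = d j * (s ^ j * t ^ (n - j)) * m := by
  intro j hj
  have := coeff_zero (n := n) (e := fun j => d j * τ - d j * (s ^ j * t ^ (n - j)) * m) (by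
    intro Y
    have h1 := h 1 Y
    rw [← sub_eq_zero] at h1
    rw [← h1]
    unfold Qp
    rw [Finset.sum_mul, Finset.sum_mul, ← Finset.sum_sub_distrib]
    refine Finset.sum_congr rfl fun j hj => ?_
    rw [mul_pow, mul_pow]; ring) j hj
  linarith

theorem Qp_inv {n : ℕ} {d : ℕ → ℝ} {u v : ℝ}
    (h : ∀ x b a, Qp n d x b = Qp n d (x + u * a) (b + v * a))
    (h1 : ∃ j ≤ n, 1 ≤ j ∧ d j ≠ 0) (h2 : ∃ j < n, d j ≠ 0) (huv : ¬ (u = 0 ∧ v = 0)) :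
    u ≠ 0 ∧ v ≠ 0 ∧ (∀ x b, Qp n d x b = d 0 * (x - u / v * b) ^ n) ∧
      ∀ j ≤ n, d j = d 0 * (n.choose j) * (-(u / v)) ^ j := by
  have hv : v ≠ 0 := by
    rintro rfl
    have hu : u ≠ 0 := fun h => huv ⟨h, rfl⟩
    obtain ⟨j, hj, hd⟩ := h2
    have := coeff_zero (n := n) (e := fun j => if j = 0 then 0 else d (n - j)) (by
      intro Y
      have h3 := h Y 1 (-Y / u)
      rw [show Y + u * (-Y / u) = 0 by field_simp; ring, zero_mul, add_zero, Qp_left_zero] at h3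
      unfold Qp at h3
      rw [← Finset.sum_range_reflect, Finset.sum_range_succ'] at h3
      rw [Finset.sum_range_succ']
      simp at h3 ⊢
      rw [← h3]
      refine Finset.sum_congr rfl fun j hj => ?_
      have : j < n := by simpa using hj
      rw [show n - (n - (j + 1)) = j + 1 by omega]) (n - j) (by omega)
    rw [if_neg (by omega), show n - (n - j) = j by omega] at this
    exact hd this
  have key : ∀ x b, Qp n d x b = d 0 * (x - u / v * b) ^ n := by
    intro x b
    rw [h x b (-b / v), show b + v * (-b / v) = 0 by field_simp; ring, Qp_right_zero]
    congr 2; ring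
  have kc : ∀ j ≤ n, d j = d 0 * (n.choose j) * (-(u / v)) ^ j := by
    intro j hj
    have := coeff_zero (n := n) (e := fun j => d j - d 0 * (n.choose j) * (-(u / v)) ^ j) (by
      intro Y
      have h3 := key 1 Y
      rw [Qp_one, show 1 - u / v * Y = -(u / v) * Y + 1 by ring, add_pow] at h3
      simp only [sub_mul, Finset.sum_sub_distrib]
      rw [h3, Finset.mul_sum, sub_eq_zero]
      refine Finset.sum_congr rfl fun j hj => ?_
      rw [mul_pow]; ring) j hj
    linarith
  refine ⟨?_, hv, key, kc⟩
  rintro rfl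
  obtain ⟨j, hj, hj1, hd⟩ := h1
  apply hd
  rw [kc j hj]
  simp; right; omega
open Filter Topology in
theorem quad_bound {g : ℝ → ℝ} (hg : ContDiffAt ℝ 2 g 0) :
    ∃ m C : ℝ, ∀ᶠ y in 𝓝 (0 : ℝ), |g y - g 0 - m * y| ≤ C * y ^ 2 := by
  have hd : DifferentiableAt ℝ (fderiv ℝ g) 0 :=
    (hg.fderiv_right (m := 1) (by norm_num)).differentiableAt (by norm_num)
  have hb := hd.hasFDerivAt.isBigO_sub
  obtain ⟨C, hC⟩ := hb.bound
  have hdiff : ∀ᶠ y in 𝓝 (0 : ℝ), DifferentiableAt ℝ g y :=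
    (hg.eventually (by simp)).mono fun y hy => hy.differentiableAt (by norm_num)
  obtain ⟨ε, hε, hall⟩ := Metric.eventually_nhds_iff.1 (hC.and hdiff)
  refine ⟨fderiv ℝ g 0 1, |C|, Metric.eventually_nhds_iff.2 ⟨ε, hε, fun y hy => ?_⟩⟩
  have := (convex_closedBall (0 : ℝ) |y|).norm_image_sub_le_of_norm_fderiv_le' (𝕜 := ℝ) (f := g)
    (φ := fderiv ℝ g 0) (C := |C| * |y|) (x := 0) (y := y) (fun z hz => by
      have : dist z 0 < ε := by
        simp at hz hy ⊢; linarith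
      exact (hall this).2) (fun z hz => by
      have h1 : dist z 0 < ε := by
        simp at hz hy ⊢; linarith
      have h2 := (hall h1).1
      refine h2.trans ?_
      simp at hz ⊢
      gcongr
      exact le_abs_self C) (by simp) (by simp)
  simp only [sub_zero, Real.norm_eq_abs] at this
  have h3 : fderiv ℝ g 0 y = fderiv ℝ g 0 1 * y := by
    rw [mul_comm, ← smul_eq_mul, ← map_smul]; simp
  rw [h3] at this
  refine this.trans (le_of_eq ?_)
  rw [mul_assoc, abs_mul_abs_self, sq]

theorem aff_line {φ : ℝ → ℝ} {m ε : ℝ} (h : ∀ b, |b| < ε → HasDerivAt φ m b) :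
    ∀ b, |b| < ε → φ b = φ 0 + m * b := by
  intro b hb
  have h0 : |(0 : ℝ)| < ε := by simpa using (abs_nonneg b).trans_lt hb
  have := (convex_ball (0 : ℝ) ε).norm_image_sub_le_of_norm_hasDerivWithin_le
    (f := fun b => φ b - m * b) (f' := fun _ => 0) (C := 0) (x := 0) (y := b) (fun z hz => by
      have h1 := (h z (by simpa using hz)).sub ((hasDerivAt_id z).const_mul m)
      simp only [mul_one, sub_self] at h1
      exact h1.hasDerivWithinAt) (by simp) (by simpa using h0) (by simpa using hb)
  simp at this
  linarith [sub_eq_zero.1 this]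

open Filter Topology in
theorem core_lemma {k : ℕ} (hk : 2 ≤ k) {c : ℝ} (hc : c ≠ 0) {F G : ℝ × ℝ → ℝ}
    (hF : ContDiffAt ℝ 2 F (0, 0)) (hG : ContDiffAt ℝ 2 G (0, 0)) (F0 : F (0, 0) = 0)
    (ht : fderiv ℝ F (0, 0) (1, 0) ≠ 0)
    (hid : ∀ᶠ p : ℝ × ℝ × ℝ in 𝓝 (0, 0, 0),
      G (p.1 + p.2.2, p.2.1 + c * p.2.2 ^ k) - G (p.1, p.2.1) =
        c * (F (p.1 + p.2.2, p.2.1 + c * p.2.2 ^ k) - F (p.1, p.2.1)) ^ k) :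
    fderiv ℝ F (0, 0) (0, 1) = 0 := by
  have hFd : ∀ᶠ p in 𝓝 ((0, 0) : ℝ × ℝ), DifferentiableAt ℝ F p :=
    (hF.eventually (by simp)).mono fun y hy => hy.differentiableAt (by norm_num)
  have hGd : ∀ᶠ p in 𝓝 ((0, 0) : ℝ × ℝ), DifferentiableAt ℝ G p :=
    (hG.eventually (by simp)).mono fun y hy => hy.differentiableAt (by norm_num)
  have hpow : ∀ a : ℝ, HasDerivAt (fun h : ℝ => a + c * h ^ k) 0 0 := by
    intro a
    have := ((hasDerivAt_pow k (0 : ℝ)).const_mul c).const_add a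
    refine this.congr_deriv ?_
    rw [zero_pow (by omega)]; simp
  have hlin : ∀ b : ℝ, HasDerivAt (fun h : ℝ => b + h) 1 0 := fun b => (hasDerivAt_id (0 : ℝ)).const_add b
  have hcurve : ∀ (f : ℝ × ℝ → ℝ) (b a : ℝ), DifferentiableAt ℝ f (b, a) →
      HasDerivAt (fun h : ℝ => f (b + h, a + c * h ^ k)) (fderiv ℝ f (b, a) (1, 0)) 0 := by
    intro f b a hf
    have e : (b + 0, a + c * (0 : ℝ) ^ k) = (b, a) := by
      rw [zero_pow (by omega)]; simp
    have := curve_deriv (f := f) (α := fun h => b + h) (β := fun h => a + c * h ^ k) (h := 0)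
      (by rw [e]; exact hf) (hlin b) (hpow a)
    simp only [e] at this
    simpa using this
  have hk0 : (0 : ℝ) ^ k = 0 := zero_pow (by omega)
  -- the identity near each nearby base point
  have hid2 := hid.eventually_nhds
  have hemb : Tendsto (fun p : ℝ × ℝ => ((p.1, p.2, 0) : ℝ × ℝ × ℝ)) (𝓝 (0, 0)) (𝓝 (0, 0, 0)) := by
    apply Continuous.tendsto' (by fun_prop) _ _ rfl
  have hid3 : ∀ᶠ p : ℝ × ℝ in 𝓝 (0, 0), ∀ᶠ h in 𝓝 (0 : ℝ),
      G (p.1 + h, p.2 + c * h ^ k) - G (p.1, p.2) =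
        c * (F (p.1 + h, p.2 + c * h ^ k) - F (p.1, p.2)) ^ k := by
    filter_upwards [hemb.eventually hid2] with p hp
    have : Tendsto (fun h : ℝ => ((p.1, p.2, h) : ℝ × ℝ × ℝ)) (𝓝 0) (𝓝 (p.1, p.2, 0)) :=
      Continuous.tendsto' (by fun_prop) _ _ rfl
    exact this.eventually hp
  -- `G` does not depend on the first variable
  have hGx : ∀ᶠ p : ℝ × ℝ in 𝓝 (0, 0), HasDerivAt (fun b => G (b, p.2)) 0 p.1 := by
    filter_upwards [hid3, hFd, hGd] with p hp hf hg
    have h1 := (hcurve G p.1 p.2 hg).sub_const (G (p.1, p.2))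
    have h2 := (((hcurve F p.1 p.2 hf).sub_const (F (p.1, p.2))).pow k).const_mul c
    have h3 := (h2.congr_of_eventuallyEq hp).unique h1
    simp [hk0] at h3
    have h4 : fderiv ℝ G (p.1, p.2) (1, 0) = 0 := by
      rw [← h3, zero_pow (by omega)]; ring
    have := curve_deriv (f := G) (α := fun h => h) (β := fun h => p.2) (h := p.1) hg
      (hasDerivAt_id _) (hasDerivAt_const _ _)
    simpa [h4] using this
  obtain ⟨ε, hε, hall⟩ := Metric.eventually_nhds_iff.1 hGx
  have hGc : ∀ b a, |b| < ε → |a| < ε → G (b, a) = G (0, a) := by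
    intro b a hb ha
    have := aff_line (φ := fun b => G (b, a)) (m := 0) (ε := ε) (fun z hz => by
      refine @hall (z, a) ?_
      simp [Prod.dist_eq, hz, ha]) b hb
    simpa using this
  have hax : Tendsto (fun b : ℝ => ((b, 0) : ℝ × ℝ)) (𝓝 0) (𝓝 (0, 0)) :=
    Continuous.tendsto' (by fun_prop) _ _ rfl
  have hsm1 : ∀ᶠ h : ℝ in 𝓝 0, |c * h ^ k| < ε := by
    have : Tendsto (fun h : ℝ => |c * h ^ k|) (𝓝 0) (𝓝 0) :=
      Continuous.tendsto' (by fun_prop) _ _ (by simp [hk0])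
    exact this.eventually (gt_mem_nhds hε)
  have hsm0 : ∀ᶠ h : ℝ in 𝓝 0, |h| < ε := by
    have : Tendsto (fun h : ℝ => |h|) (𝓝 0) (𝓝 0) :=
      Continuous.tendsto' (by fun_prop) _ _ (by simp)
    exact this.eventually (gt_mem_nhds hε)
  have hI : ∀ᶠ b : ℝ in 𝓝 0, ∀ᶠ h in 𝓝 (0 : ℝ),
      G (0, c * h ^ k) - G (0, 0) = c * (F (b + h, 0 + c * h ^ k) - F (b, 0)) ^ k := by
    filter_upwards [hax.eventually hid3, hsm0] with b hb hbs
    have hbh : ∀ᶠ h : ℝ in 𝓝 0, |b + h| < ε := by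
      have : Tendsto (fun h : ℝ => |b + h|) (𝓝 0) (𝓝 |b|) :=
        Continuous.tendsto' (by fun_prop) _ _ (by simp)
      exact this.eventually (gt_mem_nhds hbs)
    filter_upwards [hb, hbh, hsm1] with h h1 h2 h3
    rw [← h1]
    simp only [zero_add]
    rw [hGc (b + h) _ h2 h3, hGc b 0 hbs (by simpa using hε)]
  set t := fderiv ℝ F (0, 0) (1, 0) with htdef
  set u := fderiv ℝ F (0, 0) (0, 1) with hudef
  have hI0 := hI.self_of_nhds
  have hslope : ∀ b : ℝ, DifferentiableAt ℝ F (b, 0) →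
      Tendsto (fun h : ℝ => (F (b + h, 0 + c * h ^ k) - F (b, 0)) / h) (𝓝[≠] 0)
        (𝓝 (fderiv ℝ F (b, 0) (1, 0))) := by
    intro b hb
    have := (hcurve F b 0 hb).tendsto_slope_zero
    simp only [zero_add, hk0, mul_zero, add_zero] at this ⊢
    refine this.congr fun h => ?_
    simp; ring
  have hF00 : DifferentiableAt ℝ F (0, 0) := hFd.self_of_nhds
  have hFx : ∀ᶠ b : ℝ in 𝓝 0, fderiv ℝ F (b, 0) (1, 0) = t := by
    have hcont : Tendsto (fun b : ℝ => fderiv ℝ F (b, 0) (1, 0)) (𝓝 0) (𝓝 t) := by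
      have h1 : ContinuousAt (fderiv ℝ F) (0, 0) := hF.continuousAt_fderiv (by norm_num)
      have h2 := h1.tendsto.comp hax
      exact ((ContinuousLinearMap.apply ℝ ℝ ((1, 0) : ℝ × ℝ)).continuous.tendsto _).comp h2
    have hnear := hcont.eventually (Metric.ball_mem_nhds t (abs_pos.2 ht))
    filter_upwards [hI, hax.eventually hFd, hnear] with b hb hfb hn
    have l1 := (hslope b hfb).pow k
    have l2 := (hslope 0 hF00).pow k
    have : fderiv ℝ F (b, 0) (1, 0) ^ k = t ^ k := by
      refine tendsto_nhds_unique (l1.congr' ?_) l2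
      filter_upwards [hb.filter_mono nhdsWithin_le_nhds, hI0.filter_mono nhdsWithin_le_nhds]
        with h h1 h2
      rw [div_pow, div_pow]
      congr 1
      exact mul_left_cancel₀ hc (h1.symm.trans h2)
    rcases (pow_eq_pow_iff_cases).1 this with h | h | ⟨h, _⟩
    · omega
    · exact h
    · exfalso
      rw [h, Real.dist_eq, show -t - t = -(2 * t) by ring, abs_neg, abs_mul] at hn
      have := abs_pos.2 ht
      norm_num at hn
      linarith
  have hF0 : ∀ᶠ h : ℝ in 𝓝 0, F (h, 0) = t * h := by
    obtain ⟨δ, hδ, hal⟩ := Metric.eventually_nhds_iff.1 (hFx.and (hax.eventually hFd))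
    refine Metric.eventually_nhds_iff.2 ⟨δ, hδ, fun h hh => ?_⟩
    have := aff_line (φ := fun b => F (b, 0)) (m := t) (ε := δ) (fun z hz => by
      obtain ⟨h1, h2⟩ := @hal z (by simpa using hz)
      have := curve_deriv (f := F) (α := fun h => h) (β := fun h => 0) (h := z) h2
        (hasDerivAt_id _) (hasDerivAt_const _ _)
      simpa [h1] using this) h (by simpa using hh)
    simpa [F0] using this
  set ω : ℝ → ℝ := fun h => F (h, c * h ^ k) / h with hω
  have hωt : Tendsto ω (𝓝[≠] 0) (𝓝 t) := by
    have := hslope 0 hF00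
    simpa [F0] using this
  -- second-order behaviour of `ω`
  have hω2 : Tendsto (fun h => (ω h - t) / h ^ (k - 1)) (𝓝[≠] 0) (𝓝 (u * c)) := by
    have hs : HasStrictFDerivAt F (fderiv ℝ F (0, 0)) (0, 0) :=
      hF.hasStrictFDerivAt (by norm_num)
    have hcv : Tendsto (fun h : ℝ => (((h, c * h ^ k), (h, 0)) : (ℝ × ℝ) × (ℝ × ℝ))) (𝓝 0)
        (𝓝 ((0, 0), (0, 0))) :=
      Continuous.tendsto' (by fun_prop) _ _ (by simp [hk0])
    have ho := (hs.isLittleO.comp_tendsto hcv)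
    have ho2 : (fun h : ℝ => F (h, c * h ^ k) - F (h, 0) - u * (c * h ^ k)) =o[𝓝 0]
        (fun h : ℝ => h ^ k) := by
      have e1 : ∀ h : ℝ, fderiv ℝ F (0, 0) ((h, c * h ^ k) - (h, 0)) = u * (c * h ^ k) := by
        intro h
        have : ((h, c * h ^ k) - (h, 0) : ℝ × ℝ) = (c * h ^ k) • ((0, 1) : ℝ × ℝ) := by
          ext <;> simp
        rw [this, map_smul, smul_eq_mul, mul_comm]
      refine (ho.congr_left (fun h => ?_)).trans_isBigO ?_
      · simp only [Function.comp]; rw [e1]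
      · refine Asymptotics.IsBigO.of_bound |c| (Eventually.of_forall fun h => ?_)
        simp [Prod.norm_def]
        positivity
    have hl := (ho2.mono nhdsWithin_le_nhds).tendsto_div_nhds_zero (l := 𝓝[≠] (0 : ℝ))
    have hl2 := hl.add_const (u * c)
    rw [zero_add] at hl2
    refine hl2.congr' ?_
    filter_upwards [self_mem_nhdsWithin, hF0.filter_mono nhdsWithin_le_nhds] with h hne h0
    have hne' : h ≠ 0 := hne
    rw [h0]
    have : h ^ k = h ^ (k - 1) * h := by rw [← pow_succ]; congr 1; omega
    simp only [hω, this]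
    field_simp
    ring
  -- second-order behaviour of `G(0,·)`
  have hg2 : ContDiffAt ℝ 2 (fun y : ℝ => G (0, y)) 0 := by
    refine ContDiffAt.comp (0 : ℝ) (g := G) (f := fun y : ℝ => ((0, y) : ℝ × ℝ)) hG ?_
    fun_prop
  obtain ⟨m, C, hmC⟩ := quad_bound hg2
  have hch : Tendsto (fun h : ℝ => c * h ^ k) (𝓝 0) (𝓝 0) :=
    Continuous.tendsto' (by fun_prop) _ _ (by simp [hk0])
  have hb : ∀ᶠ h : ℝ in 𝓝[≠] 0, |ω h ^ k - m| ≤ |C| * |c| * |h| ^ k := by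
    filter_upwards [self_mem_nhdsWithin, (hch.eventually hmC).filter_mono nhdsWithin_le_nhds,
      hI0.filter_mono nhdsWithin_le_nhds] with h hne h1 h2
    have hne' : h ≠ 0 := hne
    simp only [zero_add, F0, sub_zero] at h2
    rw [h2] at h1
    have e : c * F (h, c * h ^ k) ^ k - m * (c * h ^ k) = (c * h ^ k) * (ω h ^ k - m) := by
      simp only [hω, div_pow]
      field_simp
    rw [e, abs_mul, ← sq_abs (c * h ^ k), sq] at h1
    have hp : 0 < |c * h ^ k| := abs_pos.2 (mul_ne_zero hc (pow_ne_zero _ hne'))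
    have h3 : |c * h ^ k| * |ω h ^ k - m| ≤ |c * h ^ k| * (|C| * |c * h ^ k|) := by
      refine h1.trans ?_
      nlinarith [le_abs_self C, mul_pos hp hp]
    have h4 := le_of_mul_le_mul_left h3 hp
    rwa [abs_mul, abs_pow, ← mul_assoc] at h4
  have habs : Tendsto (fun h : ℝ => |C| * |c| * |h| ^ k) (𝓝[≠] 0) (𝓝 0) := by
    have : Tendsto (fun h : ℝ => |C| * |c| * |h| ^ k) (𝓝 0) (𝓝 0) :=
      Continuous.tendsto' (by fun_prop) _ _ (by simp [hk0])
    exact this.mono_left nhdsWithin_le_nhds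
  have habs1 : Tendsto (fun h : ℝ => |C| * |c| * |h|) (𝓝[≠] 0) (𝓝 0) := by
    have : Tendsto (fun h : ℝ => |C| * |c| * |h|) (𝓝 0) (𝓝 0) :=
      Continuous.tendsto' (by fun_prop) _ _ (by simp)
    exact this.mono_left nhdsWithin_le_nhds
  have hm : t ^ k = m := by
    have h1 : Tendsto (fun h => ω h ^ k - m) (𝓝[≠] 0) (𝓝 0) :=
      squeeze_zero_norm' hb habs
    have h2 := (hωt.pow k).sub_const m
    exact sub_eq_zero.1 (tendsto_nhds_unique h2 h1)
  have hz : Tendsto (fun h => (ω h ^ k - t ^ k) / h ^ (k - 1)) (𝓝[≠] 0) (𝓝 0) := by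
    refine squeeze_zero_norm' ?_ habs1
    filter_upwards [self_mem_nhdsWithin, hb] with h hne h1
    have hne' : h ≠ 0 := hne
    rw [hm, Real.norm_eq_abs, abs_div, abs_pow, div_le_iff₀ (by positivity)]
    refine h1.trans (le_of_eq ?_)
    have : |h| ^ k = |h| ^ (k - 1) * |h| := by rw [← pow_succ]; congr 1; omega
    rw [this]; ring
  have hz2 : Tendsto (fun h => (ω h ^ k - t ^ k) / h ^ (k - 1)) (𝓝[≠] 0)
      (𝓝 ((∑ i ∈ Finset.range k, t ^ i * t ^ (k - 1 - i)) * (u * c))) := by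
    have h1 : Tendsto (fun h => ∑ i ∈ Finset.range k, ω h ^ i * t ^ (k - 1 - i)) (𝓝[≠] 0)
      (𝓝 (∑ i ∈ Finset.range k, t ^ i * t ^ (k - 1 - i))) :=
      tendsto_finsetSum _ fun i _ => (hωt.pow i).mul_const _
    refine (h1.mul hω2).congr fun h => ?_
    rw [← geom_sum₂_mul]; ring
  have hfin := tendsto_nhds_unique hz2 hz
  have hsum : (∑ i ∈ Finset.range k, t ^ i * t ^ (k - 1 - i)) = k * t ^ (k - 1) := by
    rw [Finset.sum_congr rfl (g := fun _ => t ^ (k - 1))]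
    · simp
    · intro i hi
      rw [← pow_add]; congr 1; simp at hi; omega
  rw [hsum] at hfin
  have hkR : (k : ℝ) ≠ 0 := by positivity
  have := pow_ne_zero (k - 1) ht
  rcases mul_eq_zero.1 hfin with h | h
  · exact absurd h (mul_ne_zero hkR this)
  · exact (mul_eq_zero.1 h).resolve_right hc
/-- `∂P/∂x` -/
def Pdx (n : ℕ) (γ : ℕ → ℝ) (x b : ℝ) : ℝ :=
  ∑ j ∈ Finset.range (n + 1), γ (j + 1) * b ^ (j + 1) * (((n + 1 - j : ℕ) : ℝ) * x ^ (n - j))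

/-- `∂P/∂b` -/
def Pdb (n : ℕ) (γ : ℕ → ℝ) (x b : ℝ) : ℝ :=
  ∑ j ∈ Finset.range (n + 1), γ (j + 1) * (((j + 1 : ℕ) : ℝ) * b ^ j) * x ^ (n + 1 - j)

/-- coefficients of `∂²P/∂x∂b` -/
def dco (n : ℕ) (γ : ℕ → ℝ) (j : ℕ) : ℝ := γ (j + 1) * ((j + 1 : ℕ) : ℝ) * ((n + 1 - j : ℕ) : ℝ)

theorem Ppoly_eq (n : ℕ) (γ : ℕ → ℝ) (x b : ℝ) : Ppoly (n + 2) γ x b =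
    ∑ j ∈ Finset.range (n + 1), γ (j + 1) * b ^ (j + 1) * x ^ (n + 1 - j) := by
  unfold Ppoly
  have e : Finset.Icc 1 (n + 2 - 1) = Finset.Ico (0 + 1) (n + 1 + 1) := by
    ext i; simp
    try omega
  rw [e, Finset.range_eq_Ico]
  refine (Finset.sum_Ico_add' (fun i => γ i * b ^ i * x ^ (n + 2 - i)) 0 (n + 1) 1).symm.trans ?_
  refine Finset.sum_congr rfl fun j hj => ?_
  rw [show n + 2 - (j + 1) = n + 1 - j by omega]

theorem Ppoly_hasDerivAt_x (n : ℕ) (γ : ℕ → ℝ) (x b : ℝ) :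
    HasDerivAt (fun x => Ppoly (n + 2) γ x b) (Pdx n γ x b) x := by
  simp only [Ppoly_eq]
  unfold Pdx
  refine HasDerivAt.fun_sum fun j hj => ?_
  have h := (hasDerivAt_pow (n + 1 - j) x).const_mul (γ (j + 1) * b ^ (j + 1))
  rwa [show n + 1 - j - 1 = n - j by omega] at h

theorem Ppoly_hasDerivAt_b (n : ℕ) (γ : ℕ → ℝ) (x b : ℝ) :
    HasDerivAt (fun b => Ppoly (n + 2) γ x b) (Pdb n γ x b) b := by
  simp only [Ppoly_eq]
  unfold Pdb
  refine HasDerivAt.fun_sum fun j hj => ?_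
  have h := ((hasDerivAt_pow (j + 1) b).const_mul (γ (j + 1))).mul_const (x ^ (n + 1 - j))
  exact h

theorem Pdx_hasDerivAt_b (n : ℕ) (γ : ℕ → ℝ) (x b : ℝ) :
    HasDerivAt (fun b => Pdx n γ x b) (Qp n (dco n γ) x b) b := by
  unfold Pdx Qp
  refine HasDerivAt.fun_sum fun j hj => ?_
  have h := ((hasDerivAt_pow (j + 1) b).const_mul (γ (j + 1))).mul_const
    (((n + 1 - j : ℕ) : ℝ) * x ^ (n - j))
  refine h.congr_deriv ?_
  simp only [dco, Nat.add_sub_cancel]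
  ring

theorem Ppoly_cont (k : ℕ) (γ : ℕ → ℝ) : Continuous (fun p : ℝ × ℝ => Ppoly k γ p.1 p.2) := by
  unfold Ppoly; fun_prop

theorem Ppoly_smooth (k : ℕ) (γ : ℕ → ℝ) : ContDiff ℝ 2 (fun p : ℝ × ℝ => Ppoly k γ p.1 p.2) := by
  unfold Ppoly; fun_prop

theorem Pdx_cont (n : ℕ) (γ : ℕ → ℝ) : Continuous (fun p : ℝ × ℝ => Pdx n γ p.1 p.2) := by
  unfold Pdx; fun_prop

theorem Pdb_cont (n : ℕ) (γ : ℕ → ℝ) : Continuous (fun p : ℝ × ℝ => Pdb n γ p.1 p.2) := by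
  unfold Pdb; fun_prop

theorem Qp_cont (n : ℕ) (d : ℕ → ℝ) : Continuous (fun p : ℝ × ℝ => Qp n d p.1 p.2) := by
  unfold Qp; fun_prop

theorem Ppoly_left (n : ℕ) (γ : ℕ → ℝ) (b : ℝ) : Ppoly (n + 2) γ 0 b = 0 := by
  rw [Ppoly_eq]
  refine Finset.sum_eq_zero fun j hj => ?_
  rw [zero_pow (by simp at hj; omega), mul_zero]

theorem Ppoly_right (n : ℕ) (γ : ℕ → ℝ) (x : ℝ) : Ppoly (n + 2) γ x 0 = 0 := by
  rw [Ppoly_eq]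
  refine Finset.sum_eq_zero fun j hj => ?_
  rw [zero_pow (by omega)]; ring

theorem Pdx_right (n : ℕ) (γ : ℕ → ℝ) (x : ℝ) : Pdx n γ x 0 = 0 := by
  unfold Pdx
  refine Finset.sum_eq_zero fun j hj => ?_
  rw [zero_pow (by omega)]; ring

theorem Pdb_left (n : ℕ) (γ : ℕ → ℝ) (b : ℝ) : Pdb n γ 0 b = 0 := by
  unfold Pdb
  refine Finset.sum_eq_zero fun j hj => ?_
  rw [zero_pow (by simp at hj; omega), mul_zero]

/-- `P` along a curve through the origin has zero derivative. -/
theorem Ppoly_curve (n : ℕ) (γ : ℕ → ℝ) {α β : ℝ → ℝ} {h α' β' : ℝ} (h0 : α h = 0) (h1 : β h = 0)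
    (hα : HasDerivAt α α' h) (hβ : HasDerivAt β β' h) :
    HasDerivAt (fun r => Ppoly (n + 2) γ (α r) (β r)) 0 h := by
  have hd : DifferentiableAt ℝ (fun p : ℝ × ℝ => Ppoly (n + 2) γ p.1 p.2) (α h, β h) :=
    (Ppoly_smooth (n + 2) γ).contDiffAt.differentiableAt (by norm_num)
  have h2 := curve_deriv (f := fun p : ℝ × ℝ => Ppoly (n + 2) γ p.1 p.2) hd hα hβ
  refine h2.congr_deriv ?_
  rw [h0, h1] at hd ⊢
  have e1 := curve_deriv (f := fun p : ℝ × ℝ => Ppoly (n + 2) γ p.1 p.2) (α := fun r => r)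
    (β := fun _ => 0) (h := 0) hd (hasDerivAt_id _) (hasDerivAt_const _ _)
  have e2 := curve_deriv (f := fun p : ℝ × ℝ => Ppoly (n + 2) γ p.1 p.2) (α := fun _ => 0)
    (β := fun r => r) (h := 0) hd (hasDerivAt_const _ _) (hasDerivAt_id _)
  simp only [Ppoly_right, Ppoly_left] at e1 e2
  have f1 := e1.unique (hasDerivAt_const _ _)
  have f2 := e2.unique (hasDerivAt_const _ _)
  simp only [mul_one, mul_zero, add_zero, zero_add] at f1 f2
  rw [f1, f2]; ring

open Filter Topology in
theorem levi_s18 {n : ℕ} {γ : ℕ → ℝ} {Ξ H A B : ℝ × ℝ → ℝ}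
    (hΞ : ∀ᶠ p in 𝓝 ((0, 0) : ℝ × ℝ), DifferentiableAt ℝ Ξ p)
    (hH : ∀ᶠ p in 𝓝 ((0, 0) : ℝ × ℝ), DifferentiableAt ℝ H p)
    (hB : ∀ᶠ p in 𝓝 ((0, 0) : ℝ × ℝ), DifferentiableAt ℝ B p)
    (hE : ∀ᶠ p : ℝ × ℝ × ℝ in 𝓝 (0, 0, 0),
      H (p.1, p.2.1 + Ppoly (n + 2) γ p.1 p.2.2) = A (p.2.1, p.2.2) +
        Ppoly (n + 2) γ (Ξ (p.1, p.2.1 + Ppoly (n + 2) γ p.1 p.2.2)) (B (p.2.1, p.2.2))) :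
    ∀ᶠ p : ℝ × ℝ × ℝ in 𝓝 (0, 0, 0),
      ∀ y, y = p.2.1 + Ppoly (n + 2) γ p.1 p.2.2 →
      fderiv ℝ H (p.1, y) (0, 1) * Qp n (dco n γ) p.1 p.2.2 =
        Qp n (dco n γ) (Ξ (p.1, y)) (B (p.2.1, p.2.2)) *
          (fderiv ℝ B (p.2.1, p.2.2) (1, 0) * (- Pdb n γ p.1 p.2.2) +
            fderiv ℝ B (p.2.1, p.2.2) (0, 1)) *
          (fderiv ℝ Ξ (p.1, y) (1, 0) + fderiv ℝ Ξ (p.1, y) (0, 1) * Pdx n γ p.1 p.2.2) +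
        Pdx n γ (Ξ (p.1, y)) (B (p.2.1, p.2.2)) *
          (fderiv ℝ Ξ (p.1, y) (0, 1) * Qp n (dco n γ) p.1 p.2.2) := by
  have hPc := Ppoly_cont (n + 2) γ
  have hty : Tendsto (fun p : ℝ × ℝ × ℝ => ((p.1, p.2.1 + Ppoly (n + 2) γ p.1 p.2.2) : ℝ × ℝ))
      (𝓝 (0, 0, 0)) (𝓝 (0, 0)) := by
    refine Continuous.tendsto' ?_ _ _ (by simp [Ppoly_left])
    have : Continuous (fun p : ℝ × ℝ × ℝ => Ppoly (n + 2) γ p.1 p.2.2) :=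
      hPc.comp (f := fun p : ℝ × ℝ × ℝ => (p.1, p.2.2)) (by fun_prop)
    fun_prop
  have htb : Tendsto (fun p : ℝ × ℝ × ℝ => ((p.2.1, p.2.2) : ℝ × ℝ)) (𝓝 (0, 0, 0)) (𝓝 (0, 0)) :=
    Continuous.tendsto' (by fun_prop) _ _ rfl
  -- first derivative in `x`
  have h1 : ∀ᶠ p : ℝ × ℝ × ℝ in 𝓝 (0, 0, 0),
      ∀ y, y = p.2.1 + Ppoly (n + 2) γ p.1 p.2.2 →
      fderiv ℝ H (p.1, y) (1, 0) + fderiv ℝ H (p.1, y) (0, 1) * Pdx n γ p.1 p.2.2 =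
        Pdx n γ (Ξ (p.1, y)) (B (p.2.1, p.2.2)) *
          (fderiv ℝ Ξ (p.1, y) (1, 0) + fderiv ℝ Ξ (p.1, y) (0, 1) * Pdx n γ p.1 p.2.2) := by
    filter_upwards [hE.eventually_nhds, hty.eventually hΞ, hty.eventually hH] with p hp dΞ dH y hy
    obtain ⟨x, a, b⟩ := p
    simp only at *
    have hc : Tendsto (fun r : ℝ => ((r, a, b) : ℝ × ℝ × ℝ)) (𝓝 x) (𝓝 (x, a, b)) :=
      Continuous.tendsto' (by fun_prop) _ _ rfl
    have hev := hc.eventually hp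
    have hβ := (Ppoly_hasDerivAt_x n γ x b).const_add a
    have l1 := curve_deriv (f := H) (α := fun r => r) dH (hasDerivAt_id x) hβ
    have l2 := curve_deriv (f := Ξ) (α := fun r => r) dΞ (hasDerivAt_id x) hβ
    have l3 := ((Ppoly_hasDerivAt_x n γ (Ξ (x, a + Ppoly (n + 2) γ x b)) (B (a, b))).comp
      x l2).const_add (A (a, b))
    have := l1.unique (l3.congr_of_eventuallyEq hev)
    rw [hy]
    simpa using this
  filter_upwards [h1.eventually_nhds, htb.eventually hB] with p hp dB y hy
  obtain ⟨x, a, b⟩ := p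
  simp only at *
  have hPb : Continuous (fun r : ℝ => Ppoly (n + 2) γ x r) :=
    hPc.comp (f := fun r : ℝ => (x, r)) (by fun_prop)
  have hc : Tendsto (fun r : ℝ => ((x, y - Ppoly (n + 2) γ x r, r) : ℝ × ℝ × ℝ)) (𝓝 b)
      (𝓝 (x, a, b)) :=
    Continuous.tendsto' (by fun_prop) _ _ (by rw [hy]; simp)
  have hev := hc.eventually hp
  have hev2 := hev.mono (fun r hr => hr y (by simp))
  simp only at hev2
  have ha : y - Ppoly (n + 2) γ x b = a := by rw [hy]; ring
  have hα := (Ppoly_hasDerivAt_b n γ x b).const_sub y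
  have l0 := curve_deriv (f := B) (α := fun r => y - Ppoly (n + 2) γ x r) (β := fun r => r) (h := b)
    (by simpa only [ha] using dB) hα (hasDerivAt_id b)
  have l1 := ((Pdx_hasDerivAt_b n γ x b).const_mul (fderiv ℝ H (x, y) (0, 1))).const_add
    (fderiv ℝ H (x, y) (1, 0))
  have l2 := ((Pdx_hasDerivAt_b n γ x b).const_mul (fderiv ℝ Ξ (x, y) (0, 1))).const_add
    (fderiv ℝ Ξ (x, y) (1, 0))
  have l3 := (Pdx_hasDerivAt_b n γ (Ξ (x, y)) (B (y - Ppoly (n + 2) γ x b, b))).comp b l0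
  have l4 := l3.mul l2
  have := l1.unique (l4.congr_of_eventuallyEq hev2)
  simp only [ha, Function.comp, mul_one] at this
  exact this
open Filter Topology in
theorem fd_tendsto {f : ℝ × ℝ → ℝ} (hf : ContDiffAt ℝ 2 f (0, 0)) (w : ℝ × ℝ) {ι : Type*}
    {l : Filter ι} {c : ι → ℝ × ℝ} (hc : Tendsto c l (𝓝 (0, 0))) :
    Tendsto (fun e => fderiv ℝ f (c e) w) l (𝓝 (fderiv ℝ f (0, 0) w)) := by
  have h1 : ContinuousAt (fderiv ℝ f) (0, 0) := hf.continuousAt_fderiv (by norm_num)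
  exact ((ContinuousLinearMap.apply ℝ ℝ w).continuous.tendsto _).comp (h1.tendsto.comp hc)

open Filter Topology in
theorem cd_ev {f : ℝ × ℝ → ℝ} (hf : ContDiffAt ℝ 2 f (0, 0)) :
    ∀ᶠ p in 𝓝 ((0, 0) : ℝ × ℝ), DifferentiableAt ℝ f p :=
  (hf.eventually (by simp)).mono fun y hy => hy.differentiableAt (by norm_num)

open Filter Topology in
theorem scaling {n : ℕ} {γ : ℕ → ℝ} {Ξ H A B : ℝ × ℝ → ℝ}
    (hΞ : ContDiffAt ℝ 2 Ξ (0, 0)) (hH : ContDiffAt ℝ 2 H (0, 0)) (hB : ContDiffAt ℝ 2 B (0, 0))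
    (Ξ0 : Ξ (0, 0) = 0) (B0 : B (0, 0) = 0)
    (hE : ∀ᶠ p : ℝ × ℝ × ℝ in 𝓝 (0, 0, 0),
      H (p.1, p.2.1 + Ppoly (n + 2) γ p.1 p.2.2) = A (p.2.1, p.2.2) +
        Ppoly (n + 2) γ (Ξ (p.1, p.2.1 + Ppoly (n + 2) γ p.1 p.2.2)) (B (p.2.1, p.2.2)))
    (x a b : ℝ) :
    Qp n (dco n γ) x b * fderiv ℝ H (0, 0) (0, 1) =
      Qp n (dco n γ) (fderiv ℝ Ξ (0, 0) (1, 0) * x + fderiv ℝ Ξ (0, 0) (0, 1) * a)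
        (fderiv ℝ B (0, 0) (1, 0) * a + fderiv ℝ B (0, 0) (0, 1) * b) *
        (fderiv ℝ B (0, 0) (0, 1) * fderiv ℝ Ξ (0, 0) (1, 0)) := by
  have hL := levi_s18 (cd_ev hΞ) (cd_ev hH) (cd_ev hB) hE
  have hc : Tendsto (fun e : ℝ => ((e * x, e * a, e * b) : ℝ × ℝ × ℝ)) (𝓝 0) (𝓝 (0, 0, 0)) :=
    Continuous.tendsto' (by fun_prop) _ _ (by simp)
  have hx : HasDerivAt (fun e : ℝ => e * x) x 0 := by simpa using (hasDerivAt_id (0 : ℝ)).mul_const x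
  have ha : HasDerivAt (fun e : ℝ => e * a) a 0 := by simpa using (hasDerivAt_id (0 : ℝ)).mul_const a
  have hb : HasDerivAt (fun e : ℝ => e * b) b 0 := by simpa using (hasDerivAt_id (0 : ℝ)).mul_const b
  set y : ℝ → ℝ := fun e => e * a + Ppoly (n + 2) γ (e * x) (e * b) with hydef
  have hy : HasDerivAt y a 0 := by
    have := ha.add (Ppoly_curve n γ (by simp) (by simp) hx hb)
    simp only [add_zero] at this
    exact this
  have y0 : y 0 = 0 := by simp [hydef, Ppoly_left]
  have hev := (hc.eventually hL).mono (fun e he => he (y e) rfl)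
  simp only at hev
  have c1 : Tendsto (fun e : ℝ => ((e * x, y e) : ℝ × ℝ)) (𝓝[≠] 0) (𝓝 (0, 0)) := by
    have := (hx.continuousAt.tendsto.prodMk_nhds hy.continuousAt.tendsto)
    simp only [y0, zero_mul] at this
    exact this.mono_left nhdsWithin_le_nhds
  have c2 : Tendsto (fun e : ℝ => ((e * a, e * b) : ℝ × ℝ)) (𝓝[≠] 0) (𝓝 (0, 0)) := by
    have := (ha.continuousAt.tendsto.prodMk_nhds hb.continuousAt.tendsto)
    simp only [zero_mul] at this
    exact this.mono_left nhdsWithin_le_nhds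
  have c3 : Tendsto (fun e : ℝ => ((e * x, e * b) : ℝ × ℝ)) (𝓝[≠] 0) (𝓝 (0, 0)) := by
    have := (hx.continuousAt.tendsto.prodMk_nhds hb.continuousAt.tendsto)
    simp only [zero_mul] at this
    exact this.mono_left nhdsWithin_le_nhds
  -- difference quotients
  have qΞ : Tendsto (fun e : ℝ => Ξ (e * x, y e) / e) (𝓝[≠] 0)
      (𝓝 (fderiv ℝ Ξ (0, 0) (1, 0) * x + fderiv ℝ Ξ (0, 0) (0, 1) * a)) := by
    have h := curve_deriv (f := Ξ) (α := fun e => e * x) (β := y) (h := 0)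
      (by simpa only [y0, zero_mul] using (cd_ev hΞ).self_of_nhds) hx hy
    simp only [y0, zero_mul] at h
    have := h.tendsto_slope_zero
    refine this.congr fun e => ?_
    simp only [zero_add, zero_mul, y0, Ξ0, sub_zero, smul_eq_mul]; ring
  have qB : Tendsto (fun e : ℝ => B (e * a, e * b) / e) (𝓝[≠] 0)
      (𝓝 (fderiv ℝ B (0, 0) (1, 0) * a + fderiv ℝ B (0, 0) (0, 1) * b)) := by
    have h := curve_deriv (f := B) (α := fun e => e * a) (β := fun e => e * b) (h := 0)
      (by simpa only [zero_mul] using (cd_ev hB).self_of_nhds) ha hb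
    simp only [zero_mul] at h
    have := h.tendsto_slope_zero
    refine this.congr fun e => ?_
    simp only [zero_add, zero_mul, B0, sub_zero, smul_eq_mul]; ring
  have qQ : Tendsto (fun e : ℝ => Qp n (dco n γ) (Ξ (e * x, y e) / e) (B (e * a, e * b) / e)) (𝓝[≠] 0)
      (𝓝 (Qp n (dco n γ) (fderiv ℝ Ξ (0, 0) (1, 0) * x + fderiv ℝ Ξ (0, 0) (0, 1) * a)
        (fderiv ℝ B (0, 0) (1, 0) * a + fderiv ℝ B (0, 0) (0, 1) * b))) :=
    ((Qp_cont n (dco n γ)).tendsto _).comp (qΞ.prodMk_nhds qB)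
  have qdx : Tendsto (fun e : ℝ => Pdx n γ (e * x) (e * b)) (𝓝[≠] 0) (𝓝 0) := by
    have := ((Pdx_cont n γ).tendsto (0, 0)).comp c3
    simpa only [Pdx_right, Function.comp_def] using this
  have qdb : Tendsto (fun e : ℝ => Pdb n γ (e * x) (e * b)) (𝓝[≠] 0) (𝓝 0) := by
    have := ((Pdb_cont n γ).tendsto (0, 0)).comp c3
    simpa only [Pdb_left, Function.comp_def] using this
  have qdX : Tendsto (fun e : ℝ => Pdx n γ (Ξ (e * x, y e)) (B (e * a, e * b))) (𝓝[≠] 0) (𝓝 0) := by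
    have e1 := hΞ.continuousAt.tendsto.comp c1
    have e2 := hB.continuousAt.tendsto.comp c2
    have := ((Pdx_cont n γ).tendsto _).comp (e1.prodMk_nhds e2)
    simpa only [Ξ0, B0, Pdx_right, Function.comp_def] using this
  have lhs := (fd_tendsto hH (0, 1) c1).mul_const (Qp n (dco n γ) x b)
  have rhs := ((qQ.mul (((fd_tendsto hB (1, 0) c2).mul qdb.neg).add (fd_tendsto hB (0, 1) c2))).mul
    ((fd_tendsto hΞ (1, 0) c1).add ((fd_tendsto hΞ (0, 1) c1).mul qdx))).add
    (qdX.mul ((fd_tendsto hΞ (0, 1) c1).mul_const (Qp n (dco n γ) x b)))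
  have := tendsto_nhds_unique (lhs.congr' ?_) rhs
  · rw [mul_comm, this]; ring
  · filter_upwards [self_mem_nhdsWithin, hev.filter_mono nhdsWithin_le_nhds] with e hne h
    have hne' : e ≠ 0 := hne
    have e1 : Qp n (dco n γ) (Ξ (e * x, y e)) (B (e * a, e * b)) =
        e ^ n * Qp n (dco n γ) (Ξ (e * x, y e) / e) (B (e * a, e * b) / e) := by
      rw [← Qp_scale, mul_div_cancel₀ _ hne', mul_div_cancel₀ _ hne']
    rw [Qp_scale, e1] at h
    apply mul_left_cancel₀ (pow_ne_zero n hne')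
    linear_combination h

theorem special_P {n : ℕ} {γ : ℕ → ℝ} {u v : ℝ} (hu : u ≠ 0) (hv : v ≠ 0)
    (h0 : dco n γ 0 ≠ 0)
    (hd : ∀ j ≤ n, dco n γ j = dco n γ 0 * (n.choose j) * (-(u / v)) ^ j) :
    ∃ c : ℝ, c ≠ 0 ∧ ∀ X Y, Ppoly (n + 2) γ (X / v) (Y / u) =
      c * ((X - Y) ^ (n + 2) - X ^ (n + 2) - (-Y) ^ (n + 2)) := by
  set d0 := dco n γ 0 with hd0
  refine ⟨-d0 / ((n + 2) * (n + 1) * u * v ^ (n + 1)), ?_, fun X Y => ?_⟩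
  · refine div_ne_zero (neg_ne_zero.2 h0) ?_
    have : ((n : ℝ) + 2) * (n + 1) ≠ 0 := by positivity
    exact mul_ne_zero (mul_ne_zero this hu) (pow_ne_zero _ hv)
  have hb : (X - Y) ^ (n + 2) - X ^ (n + 2) - (-Y) ^ (n + 2) =
      ∑ j ∈ Finset.range (n + 1), (-Y) ^ (j + 1) * X ^ (n + 1 - j) * ((n + 2).choose (j + 1)) := by
    rw [show X - Y = -Y + X by ring, add_pow, Finset.sum_range_succ, Finset.sum_range_succ']
    simp
    ring
  rw [hb, Ppoly_eq, Finset.mul_sum]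
  refine Finset.sum_congr rfl fun j hj => ?_
  have hj' : j ≤ n := by simp at hj; omega
  have h1 : ((n + 2).choose (j + 1) : ℝ) * ((j + 1 : ℕ) : ℝ) * ((n + 1 - j : ℕ) : ℝ) =
      (n + 2) * (n + 1) * n.choose j := by
    have e1 := Nat.add_one_mul_choose_eq (n + 1) j
    have e2 := Nat.choose_mul_succ_eq n j
    have e1' : ((n : ℝ) + 2) * ((n + 1).choose j) = (n + 2).choose (j + 1) * ((j + 1 : ℕ) : ℝ) := by
      have := congrArg (Nat.cast (R := ℝ)) e1
      push_cast at this ⊢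
      linear_combination this
    have e2' : (n.choose j : ℝ) * (n + 1) = (n + 1).choose j * ((n + 1 - j : ℕ) : ℝ) := by
      have := congrArg (Nat.cast (R := ℝ)) e2
      rw [Nat.cast_mul, Nat.cast_mul] at this
      push_cast at this ⊢
      linear_combination this
    linear_combination (-((n + 1 - j : ℕ) : ℝ)) * e1' - ((n : ℝ) + 2) * e2'
  have h2 := hd j hj'
  unfold dco at h2
  have p1 : ((j + 1 : ℕ) : ℝ) ≠ 0 := by positivity
  have p2 : ((n + 1 - j : ℕ) : ℝ) ≠ 0 := by
    have : n + 1 - j ≠ 0 := by omega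
    exact_mod_cast this
  have p3 : ((n : ℝ) + 2) * (n + 1) ≠ 0 := by positivity
  have h3 : γ (j + 1) * ((n + 2) * (n + 1)) = d0 * (n + 2).choose (j + 1) * (-(u / v)) ^ j := by
    apply mul_right_cancel₀ (mul_ne_zero p1 p2)
    linear_combination ((n : ℝ) + 2) * (n + 1) * h2 - d0 * (-(u / v)) ^ j * h1
  have h4 : γ (j + 1) = d0 * (n + 2).choose (j + 1) * (-(u / v)) ^ j / ((n + 2) * (n + 1)) := by
    rw [eq_div_iff p3]; exact h3
  rw [h4, div_pow, div_pow, neg_pow (u / v), div_pow, neg_pow Y (j + 1)]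
  have p4 : v ^ (n + 1) = v ^ j * v ^ (n + 1 - j) := by rw [← pow_add]; congr 1; omega
  have p5 : (n : ℝ) + 2 ≠ 0 := by positivity
  have p6 : (n : ℝ) + 1 ≠ 0 := by positivity
  rw [p4]
  field_simp
  ring

open Filter Topology in
theorem special_case {n : ℕ} (hn : 1 ≤ n) {γ : ℕ → ℝ} {Ξ H A B : ℝ × ℝ → ℝ}
    (hΞ : ContDiffAt ℝ 2 Ξ (0, 0)) (hH : ContDiffAt ℝ 2 H (0, 0)) (hB : ContDiffAt ℝ 2 B (0, 0))
    (Ξ0 : Ξ (0, 0) = 0)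
    (ht : fderiv ℝ Ξ (0, 0) (1, 0) ≠ 0) (hs : fderiv ℝ B (0, 0) (0, 1) ≠ 0)
    (hE : ∀ᶠ p : ℝ × ℝ × ℝ in 𝓝 (0, 0, 0),
      H (p.1, p.2.1 + Ppoly (n + 2) γ p.1 p.2.2) = A (p.2.1, p.2.2) +
        Ppoly (n + 2) γ (Ξ (p.1, p.2.1 + Ppoly (n + 2) γ p.1 p.2.2)) (B (p.2.1, p.2.2)))
    {u v : ℝ} (hu : u ≠ 0) (hv : v ≠ 0) (h0 : dco n γ 0 ≠ 0)
    (hQ : ∀ x b, Qp n (dco n γ) x b = dco n γ 0 * (x - u / v * b) ^ n)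
    (hd : ∀ j ≤ n, dco n γ j = dco n γ 0 * (n.choose j) * (-(u / v)) ^ j) :
    fderiv ℝ Ξ (0, 0) (0, 1) = 0 := by
  obtain ⟨c, hc, hP⟩ := special_P hu hv h0 hd
  have hP' : ∀ x b, Ppoly (n + 2) γ x b =
      c * ((v * x - u * b) ^ (n + 2) - (v * x) ^ (n + 2) - (-(u * b)) ^ (n + 2)) := by
    intro x b
    rw [← hP, mul_div_cancel_left₀ _ hv, mul_div_cancel_left₀ _ hu]
  have hL := levi_s18 (cd_ev hΞ) (cd_ev hH) (cd_ev hB) hE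
  have hz : (0 : ℝ) ^ (n + 2) = 0 := zero_pow (by omega)
  set ψ : ℝ × ℝ → ℝ × ℝ := fun q => (q.1 / v, q.2 - c * q.1 ^ (n + 2)) with hψ
  have ψ0 : ψ (0, 0) = (0, 0) := by simp [hψ]
  have hψs : ContDiff ℝ 2 ψ := by
    have h1 : ContDiff ℝ 2 (fun q : ℝ × ℝ => q.1 / v) := contDiff_fst.div_const v
    have h2 : ContDiff ℝ 2 (fun q : ℝ × ℝ => q.2 - c * q.1 ^ (n + 2)) := by fun_prop
    exact h1.prodMk h2
  set F : ℝ × ℝ → ℝ := fun q => v * Ξ (ψ q) with hF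
  set G : ℝ × ℝ → ℝ := fun q => H (ψ q) + c * F q ^ (n + 2) with hG
  have hΞψ : ContDiffAt ℝ 2 (fun q => Ξ (ψ q)) (0, 0) :=
    ContDiffAt.comp (0, 0) (g := Ξ) (f := ψ) (by rw [ψ0]; exact hΞ) hψs.contDiffAt
  have hHψ : ContDiffAt ℝ 2 (fun q => H (ψ q)) (0, 0) :=
    ContDiffAt.comp (0, 0) (g := H) (f := ψ) (by rw [ψ0]; exact hH) hψs.contDiffAt
  have hFs : ContDiffAt ℝ 2 F (0, 0) := contDiffAt_const.mul hΞψ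
  have hGs : ContDiffAt ℝ 2 G (0, 0) := hHψ.add (contDiffAt_const.mul (hFs.pow _))
  have F0 : F (0, 0) = 0 := by simp only [hF, ψ0, Ξ0, mul_zero]
  have dΞ := (cd_ev hΞ).self_of_nhds
  have dF := (cd_ev hFs).self_of_nhds
  have Fx : fderiv ℝ F (0, 0) (1, 0) = fderiv ℝ Ξ (0, 0) (1, 0) := by
    have l1 := curve_deriv (f := F) (α := fun r => r) (β := fun _ => 0) (h := 0) dF
      (hasDerivAt_id _) (hasDerivAt_const _ _)
    have hp : HasDerivAt (fun r : ℝ => 0 - c * r ^ (n + 2)) 0 0 := by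
      have := ((hasDerivAt_pow (n + 2) (0 : ℝ)).const_mul c).const_sub 0
      refine this.congr_deriv ?_
      rw [zero_pow (by omega)]; simp
    have l2 := (curve_deriv (f := Ξ) (α := fun r => r / v) (β := fun r => 0 - c * r ^ (n + 2))
      (h := 0) (by simpa using dΞ) ((hasDerivAt_id _).div_const v) hp).const_mul v
    have := l1.unique l2
    simp only [hz, zero_div, mul_zero, sub_zero, add_zero, mul_one] at this
    rw [this]; field_simp
  have Fy : fderiv ℝ F (0, 0) (0, 1) = v * fderiv ℝ Ξ (0, 0) (0, 1) := by
    have l1 := curve_deriv (f := F) (α := fun _ => 0) (β := fun r => r) (h := 0) dF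
      (hasDerivAt_const _ _) (hasDerivAt_id _)
    have l2 := (curve_deriv (f := Ξ) (α := fun _ => 0 / v) (β := fun r => r - c * 0 ^ (n + 2))
      (h := 0) (by simpa using dΞ) (hasDerivAt_const _ _)
      ((hasDerivAt_id _).sub_const (c * 0 ^ (n + 2)))).const_mul v
    have := l1.unique l2
    simpa only [hz, zero_div, mul_zero, sub_zero, zero_add, mul_one] using this
  -- points of `S`
  have tP : Tendsto (fun p : ℝ × ℝ × ℝ =>
      (((p.1 + p.2.2) / v, p.2.1 + c * (-p.1) ^ (n + 2), p.1 / u) : ℝ × ℝ × ℝ))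
      (𝓝 (0, 0, 0)) (𝓝 (0, 0, 0)) :=
    Continuous.tendsto' (by fun_prop) _ _ (by simp)
  have tP0 : Tendsto (fun p : ℝ × ℝ × ℝ =>
      ((p.1 / v, p.2.1 + c * (-p.1) ^ (n + 2), p.1 / u) : ℝ × ℝ × ℝ))
      (𝓝 (0, 0, 0)) (𝓝 (0, 0, 0)) :=
    Continuous.tendsto' (by fun_prop) _ _ (by simp)
  have tψ : Tendsto (fun p : ℝ × ℝ × ℝ => ψ (p.1, p.2.1)) (𝓝 (0, 0, 0)) (𝓝 (0, 0)) :=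
    Continuous.tendsto' (hψs.continuous.comp (f := fun p : ℝ × ℝ × ℝ => (p.1, p.2.1)) (by fun_prop))
      _ _ ψ0
  have tB : Tendsto (fun p : ℝ × ℝ × ℝ => ((p.2.1 + c * (-p.1) ^ (n + 2), p.1 / u) : ℝ × ℝ))
      (𝓝 (0, 0, 0)) (𝓝 (0, 0)) :=
    Continuous.tendsto' (by fun_prop) _ _ (by simp)
  have tV : Tendsto (fun p : ℝ × ℝ × ℝ => ((p.1 / v, p.1 / u) : ℝ × ℝ)) (𝓝 (0, 0, 0)) (𝓝 (0, 0)) :=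
    Continuous.tendsto' (by fun_prop) _ _ (by simp)
  have tdb : Tendsto (fun p : ℝ × ℝ × ℝ => Pdb n γ (p.1 / v) (p.1 / u)) (𝓝 (0, 0, 0)) (𝓝 0) := by
    have := ((Pdb_cont n γ).tendsto (0, 0)).comp tV
    simpa only [Pdb_left, Function.comp_def] using this
  have tdx : Tendsto (fun p : ℝ × ℝ × ℝ => Pdx n γ (p.1 / v) (p.1 / u)) (𝓝 (0, 0, 0)) (𝓝 0) := by
    have := ((Pdx_cont n γ).tendsto (0, 0)).comp tV
    simpa only [Pdx_right, Function.comp_def] using this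
  have nz1 := (((fd_tendsto hB (1, 0) tB).mul tdb.neg).add (fd_tendsto hB (0, 1) tB)).eventually_ne (show _ ≠ (0 : ℝ) by simpa using hs)
  have nz2 := ((fd_tendsto hΞ (1, 0) tψ).add ((fd_tendsto hΞ (0, 1) tψ).mul tdx)).eventually_ne (show _ ≠ (0 : ℝ) by simpa using ht)
  have hid : ∀ᶠ p : ℝ × ℝ × ℝ in 𝓝 (0, 0, 0),
      G (p.1 + p.2.2, p.2.1 + c * p.2.2 ^ (n + 2)) - G (p.1, p.2.1) =
        c * (F (p.1 + p.2.2, p.2.1 + c * p.2.2 ^ (n + 2)) - F (p.1, p.2.1)) ^ (n + 2) := by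
    filter_upwards [tP.eventually hE, tP0.eventually hE, tP0.eventually hL, nz1, nz2]
      with p e1 e0 l m1 m2
    obtain ⟨b, a, h⟩ := p
    simp only at e1 e0 l m1 m2 ⊢
    have y1 : a + c * (-b) ^ (n + 2) + Ppoly (n + 2) γ ((b + h) / v) (b / u) =
        a + c * h ^ (n + 2) - c * (b + h) ^ (n + 2) := by
      rw [hP, show b + h - b = h by ring]; ring
    have y0 : a + c * (-b) ^ (n + 2) + Ppoly (n + 2) γ (b / v) (b / u) =
        a - c * b ^ (n + 2) := by
      rw [hP, sub_self, hz]; ring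
    have l' := l (a - c * b ^ (n + 2)) y0.symm
    have q0 : Qp n (dco n γ) (b / v) (b / u) = 0 := by
      rw [hQ, show b / v - u / v * (b / u) = 0 by field_simp; ring, zero_pow (by omega), mul_zero]
    rw [q0, mul_zero, mul_zero, mul_zero, add_zero] at l'
    have q1 := ((mul_eq_zero.1 l'.symm).resolve_right m2)
    have q2 := (mul_eq_zero.1 q1).resolve_right m1
    rw [hQ] at q2
    have q3 := pow_eq_zero_iff (by omega) |>.1 ((mul_eq_zero.1 q2).resolve_left h0)
    have loc : v * Ξ (b / v, a - c * b ^ (n + 2)) = u * B (a + c * (-b) ^ (n + 2), b / u) := by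
      field_simp at q3
      linarith
    rw [y1, hP'] at e1
    rw [y0, hP'] at e0
    simp only [hG, hF, hψ]
    rw [e1, e0, ← loc, sub_self, hz]
    ring
  have := core_lemma (by omega) hc hFs hGs F0 (by rw [Fx]; exact ht) hid
  rw [Fy] at this
  exact (mul_eq_zero.1 this).resolve_left hv
/-- let `k > 2` and `γᵢ` be not all zero, with `γᵢ ≠ 0` for some
`i ≥ 2` and for some `i ≤ k−2`; let `S = {y = a + P(x,b)}` in
`ℝ⁴ = ℝ²_{xy} × ℝ²_{ab}` (coordinates `(x,y,a,b)`).  If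
`Φ = (Ξ(x,y), H(x,y), A(a,b), B(a,b))` is a smooth diffeomorphism of split
(para-holomorphic) form from a neighbourhood of `0` onto its image, with
`Φ(0) = 0` and `Φ(S ∩ dom Φ) ⊆ S`, then `dΦ(0)` is diagonal: with
`t = ∂Ξ/∂x(0)`, `s = ∂B/∂b(0)`, `τ = ∂H/∂y(0)` one has
`∂Ξ/∂y(0) = ∂H/∂x(0) = ∂A/∂b(0) = ∂B/∂a(0) = 0`, `∂A/∂a(0) = τ`, and
`τ = sⁱ t^{k-i}` for every `i` with `γᵢ ≠ 0`. -/
theorem stmt_18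
    (k : ℕ) (hk : 2 < k) (γ : ℕ → ℝ)
    (hhi : ∃ i ∈ Finset.Icc 1 (k - 1), 2 ≤ i ∧ γ i ≠ 0)
    (hlo : ∃ i ∈ Finset.Icc 1 (k - 1), i ≤ k - 2 ∧ γ i ≠ 0)
    (S : Set (ℝ × ℝ × ℝ × ℝ))
    (hS : S = {q : ℝ × ℝ × ℝ × ℝ | q.2.1 = q.2.2.1 + Ppoly k γ q.1 q.2.2.2})
    (D : Set (ℝ × ℝ × ℝ × ℝ)) (hD : IsOpen D) (hD0 : (0 : ℝ × ℝ × ℝ × ℝ) ∈ D)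
    (Ξ H A B : ℝ × ℝ → ℝ)
    (Φ : (ℝ × ℝ × ℝ × ℝ) → ℝ × ℝ × ℝ × ℝ)
    (hΦ : Φ = fun q => (Ξ (q.1, q.2.1), H (q.1, q.2.1),
      A (q.2.2.1, q.2.2.2), B (q.2.2.1, q.2.2.2)))
    (hΦ0 : Φ 0 = 0)
    (hsm : ContDiffOn ℝ (⊤ : ℕ∞) Φ D) (hinj : Set.InjOn Φ D)
    (hopen : IsOpen (Φ '' D))
    (hdiffeo : ∃ Φinv : (ℝ × ℝ × ℝ × ℝ) → ℝ × ℝ × ℝ × ℝ,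
      ContDiffOn ℝ (⊤ : ℕ∞) Φinv (Φ '' D) ∧ ∀ q ∈ D, Φinv (Φ q) = q)
    (hmaps : Φ '' (S ∩ D) ⊆ S) :
    fderiv ℝ Ξ (0, 0) (0, 1) = 0 ∧
    fderiv ℝ H (0, 0) (1, 0) = 0 ∧
    fderiv ℝ A (0, 0) (0, 1) = 0 ∧
    fderiv ℝ B (0, 0) (1, 0) = 0 ∧
    fderiv ℝ A (0, 0) (1, 0) = fderiv ℝ H (0, 0) (0, 1) ∧
    ∀ i ∈ Finset.Icc 1 (k - 1), γ i ≠ 0 →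
      fderiv ℝ H (0, 0) (0, 1)
        = (fderiv ℝ B (0, 0) (0, 1)) ^ i * (fderiv ℝ Ξ (0, 0) (1, 0)) ^ (k - i) := by
  have hk2 : ∃ n, k = n + 2 ∧ 1 ≤ n := ⟨k - 2, by omega, by omega⟩
  obtain ⟨n, rfl, hn⟩ := hk2
  have hz := hΦ0
  rw [hΦ] at hz
  simp only [Prod.mk_eq_zero, Prod.fst_zero, Prod.snd_zero] at hz
  obtain ⟨Ξ0, H0, A0, B0⟩ := hz
  have hΦs : ContDiffAt ℝ 2 Φ (0, 0, 0, 0) :=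
    (hsm.contDiffAt (hD.mem_nhds hD0)).of_le ((WithTop.coe_le_coe (b := (2:ℕ∞)) (a := ⊤)).2 le_top)
  have i1 : ContDiffAt ℝ 2 (fun q : ℝ × ℝ => Φ (q.1, q.2, 0, 0)) (0, 0) :=
    ContDiffAt.comp (0, 0) (g := Φ) (f := fun q : ℝ × ℝ => ((q.1, q.2, 0, 0) : ℝ × ℝ × ℝ × ℝ))
      hΦs (by fun_prop)
  have i2 : ContDiffAt ℝ 2 (fun q : ℝ × ℝ => Φ (0, 0, q.1, q.2)) (0, 0) :=
    ContDiffAt.comp (0, 0) (g := Φ) (f := fun q : ℝ × ℝ => ((0, 0, q.1, q.2) : ℝ × ℝ × ℝ × ℝ))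
      hΦs (by fun_prop)
  have hΞ : ContDiffAt ℝ 2 Ξ (0, 0) := by
    have := i1.fst
    simpa only [hΦ] using this
  have hH : ContDiffAt ℝ 2 H (0, 0) := by
    have := i1.snd.fst
    simpa only [hΦ] using this
  have hA : ContDiffAt ℝ 2 A (0, 0) := by
    have := i2.snd.snd.fst
    simpa only [hΦ] using this
  have hB : ContDiffAt ℝ 2 B (0, 0) := by
    have := i2.snd.snd.snd
    simpa only [hΦ] using this
  have dΞ := (cd_ev hΞ).self_of_nhds
  have dH := (cd_ev hH).self_of_nhds
  have dA := (cd_ev hA).self_of_nhds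
  have dB := (cd_ev hB).self_of_nhds
  -- the basic identity
  have hE : ∀ᶠ p : ℝ × ℝ × ℝ in nhds (0, 0, 0),
      H (p.1, p.2.1 + Ppoly (n + 2) γ p.1 p.2.2) = A (p.2.1, p.2.2) +
        Ppoly (n + 2) γ (Ξ (p.1, p.2.1 + Ppoly (n + 2) γ p.1 p.2.2)) (B (p.2.1, p.2.2)) := by
    have tc : Filter.Tendsto (fun p : ℝ × ℝ × ℝ =>
        ((p.1, p.2.1 + Ppoly (n + 2) γ p.1 p.2.2, p.2.1, p.2.2) : ℝ × ℝ × ℝ × ℝ))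
        (nhds (0, 0, 0)) (nhds 0) := by
      have : Continuous (fun p : ℝ × ℝ × ℝ => Ppoly (n + 2) γ p.1 p.2.2) :=
        (Ppoly_cont (n + 2) γ).comp (f := fun p : ℝ × ℝ × ℝ => (p.1, p.2.2)) (by fun_prop)
      refine Continuous.tendsto' (by fun_prop) _ _ ?_
      simp [Ppoly_left]
    filter_upwards [tc.eventually (hD.mem_nhds hD0)] with p hp
    have hm := hmaps (Set.mem_image_of_mem Φ
      (show (p.1, p.2.1 + Ppoly (n + 2) γ p.1 p.2.2, p.2.1, p.2.2) ∈ S ∩ D from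
        ⟨by rw [hS]; rfl, hp⟩))
    rw [hS, hΦ] at hm
    exact hm
  -- partial derivatives along the axes
  have axx : ∀ f : ℝ × ℝ → ℝ, DifferentiableAt ℝ f (0, 0) →
      HasDerivAt (fun r => f (r, 0)) (fderiv ℝ f (0, 0) (1, 0)) 0 := by
    intro f hf
    have := curve_deriv (f := f) (α := fun r => r) (β := fun _ => 0) (h := 0) hf
      (hasDerivAt_id _) (hasDerivAt_const _ _)
    simpa using this
  have axy : ∀ f : ℝ × ℝ → ℝ, DifferentiableAt ℝ f (0, 0) →
      HasDerivAt (fun r => f (0, r)) (fderiv ℝ f (0, 0) (0, 1)) 0 := by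
    intro f hf
    have := curve_deriv (f := f) (α := fun _ => 0) (β := fun r => r) (h := 0) hf
      (hasDerivAt_const _ _) (hasDerivAt_id _)
    simpa using this
  have Hx : fderiv ℝ H (0, 0) (1, 0) = 0 := by
    have tc : Filter.Tendsto (fun r : ℝ => ((r, 0, 0) : ℝ × ℝ × ℝ)) (nhds 0) (nhds (0, 0, 0)) :=
      Continuous.tendsto' (by fun_prop) _ _ rfl
    have hev := tc.eventually hE
    simp only [Ppoly_right, add_zero, A0, B0] at hev
    exact (axx H dH).unique ((hasDerivAt_const (0 : ℝ) (0 : ℝ)).congr_of_eventuallyEq hev)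
  have Ab : fderiv ℝ A (0, 0) (0, 1) = 0 := by
    have tc : Filter.Tendsto (fun r : ℝ => ((0, 0, r) : ℝ × ℝ × ℝ)) (nhds 0) (nhds (0, 0, 0)) :=
      Continuous.tendsto' (by fun_prop) _ _ rfl
    have hev := tc.eventually hE
    simp only [Ppoly_left, add_zero, H0, Ξ0] at hev
    exact (axy A dA).unique ((hasDerivAt_const (0 : ℝ) (0 : ℝ)).congr_of_eventuallyEq
      (hev.mono fun r hr => hr.symm))
  have Aa : fderiv ℝ A (0, 0) (1, 0) = fderiv ℝ H (0, 0) (0, 1) := by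
    have tc : Filter.Tendsto (fun r : ℝ => ((0, r, 0) : ℝ × ℝ × ℝ)) (nhds 0) (nhds (0, 0, 0)) :=
      Continuous.tendsto' (by fun_prop) _ _ rfl
    have hev := tc.eventually hE
    simp only [Ppoly_left, add_zero] at hev
    have l1 := (axx A dA).add (Ppoly_curve n γ Ξ0 B0 (axy Ξ dΞ) (axx B dB))
    have l2 := (axy H dH).unique (l1.congr_of_eventuallyEq hev)
    rw [add_zero] at l2
    exact l2.symm
  -- nondegeneracy
  obtain ⟨Φinv, hinvs, hinv⟩ := hdiffeo
  have hinvd : DifferentiableAt ℝ Φinv (0, 0, 0, 0) := by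
    have h0 : (0 : ℝ × ℝ × ℝ × ℝ) ∈ Φ '' D := ⟨0, hD0, hΦ0⟩
    exact (hinvs.contDiffAt (hopen.mem_nhds h0)).differentiableAt (by simp)
  have ht : fderiv ℝ Ξ (0, 0) (1, 0) ≠ 0 := by
    intro h
    have e1 := axx Ξ dΞ
    have e2 := axx H dH
    rw [h] at e1
    rw [Hx] at e2
    have e3 : HasDerivAt (fun r : ℝ => ((Ξ (r, 0), H (r, 0), 0, 0) : ℝ × ℝ × ℝ × ℝ)) 0 0 :=
      e1.prodMk (e2.prodMk ((hasDerivAt_const _ _).prodMk (hasDerivAt_const _ _)))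
    have e4 := HasFDerivAt.comp_hasDerivAt (0 : ℝ) (l := Φinv)
      (f := fun r : ℝ => ((Ξ (r, 0), H (r, 0), 0, 0) : ℝ × ℝ × ℝ × ℝ))
      (by rw [Ξ0, H0]; exact hinvd.hasFDerivAt) e3
    rw [map_zero] at e4
    have tc : Filter.Tendsto (fun r : ℝ => ((r, 0, 0, 0) : ℝ × ℝ × ℝ × ℝ)) (nhds 0) (nhds 0) :=
      Continuous.tendsto' (by fun_prop) _ _ rfl
    have hev : (fun r : ℝ => ((r, 0, 0, 0) : ℝ × ℝ × ℝ × ℝ)) =ᶠ[nhds 0]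
        (Φinv ∘ fun r : ℝ => ((Ξ (r, 0), H (r, 0), 0, 0) : ℝ × ℝ × ℝ × ℝ)) := by
      filter_upwards [tc.eventually (hD.mem_nhds hD0)] with r hr
      have := hinv _ hr
      rw [hΦ] at this
      simp only [A0, B0] at this
      exact this.symm
    have e5 := e4.congr_of_eventuallyEq hev
    have e6 : HasDerivAt (fun r : ℝ => ((r, 0, 0, 0) : ℝ × ℝ × ℝ × ℝ)) (1, 0, 0, 0) 0 :=
      (hasDerivAt_id _).prodMk ((hasDerivAt_const _ _).prodMk
        ((hasDerivAt_const _ _).prodMk (hasDerivAt_const _ _)))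
    have := congrArg Prod.fst (e6.unique e5)
    simp at this
  have hs : fderiv ℝ B (0, 0) (0, 1) ≠ 0 := by
    intro h
    have e1 := axy B dB
    have e2 := axy A dA
    rw [h] at e1
    rw [Ab] at e2
    have e3 : HasDerivAt (fun r : ℝ => ((0, 0, A (0, r), B (0, r)) : ℝ × ℝ × ℝ × ℝ)) 0 0 :=
      (hasDerivAt_const _ _).prodMk ((hasDerivAt_const _ _).prodMk (e2.prodMk e1))
    have e4 := HasFDerivAt.comp_hasDerivAt (0 : ℝ) (l := Φinv)
      (f := fun r : ℝ => ((0, 0, A (0, r), B (0, r)) : ℝ × ℝ × ℝ × ℝ))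
      (by rw [A0, B0]; exact hinvd.hasFDerivAt) e3
    rw [map_zero] at e4
    have tc : Filter.Tendsto (fun r : ℝ => ((0, 0, 0, r) : ℝ × ℝ × ℝ × ℝ)) (nhds 0) (nhds 0) :=
      Continuous.tendsto' (by fun_prop) _ _ rfl
    have hev : (fun r : ℝ => ((0, 0, 0, r) : ℝ × ℝ × ℝ × ℝ)) =ᶠ[nhds 0]
        (Φinv ∘ fun r : ℝ => ((0, 0, A (0, r), B (0, r)) : ℝ × ℝ × ℝ × ℝ)) := by
      filter_upwards [tc.eventually (hD.mem_nhds hD0)] with r hr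
      have := hinv _ hr
      rw [hΦ] at this
      simp only [Ξ0, H0] at this
      exact this.symm
    have e5 := e4.congr_of_eventuallyEq hev
    have e6 : HasDerivAt (fun r : ℝ => ((0, 0, 0, r) : ℝ × ℝ × ℝ × ℝ)) (0, 0, 0, 1) 0 :=
      (hasDerivAt_const _ _).prodMk ((hasDerivAt_const _ _).prodMk
        ((hasDerivAt_const _ _).prodMk (hasDerivAt_id _)))
    have := congrArg (fun q : ℝ × ℝ × ℝ × ℝ => q.2.2.2) (e6.unique e5)
    simp at this
  have hsc := scaling hΞ hH hB Ξ0 B0 hE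
  set t := fderiv ℝ Ξ (0, 0) (1, 0) with htd
  set u := fderiv ℝ Ξ (0, 0) (0, 1) with hud
  set v := fderiv ℝ B (0, 0) (1, 0) with hvd
  set s := fderiv ℝ B (0, 0) (0, 1) with hsd
  set τ := fderiv ℝ H (0, 0) (0, 1) with hτd
  have hsc0 : ∀ x b, Qp n (dco n γ) x b * τ = Qp n (dco n γ) (t * x) (s * b) * (s * t) := by
    intro x b
    simpa using hsc x 0 b
  have hco := Qp_coeff hsc0
  have dne : ∀ j ≤ n, γ (j + 1) ≠ 0 → dco n γ j ≠ 0 := by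
    intro j hj hg
    have p1 : ((j + 1 : ℕ) : ℝ) ≠ 0 := by positivity
    have p2 : ((n + 1 - j : ℕ) : ℝ) ≠ 0 := by
      have : n + 1 - j ≠ 0 := by omega
      exact_mod_cast this
    exact mul_ne_zero (mul_ne_zero hg p1) p2
  have hfin : ∀ i ∈ Finset.Icc 1 (n + 2 - 1), γ i ≠ 0 → τ = s ^ i * t ^ (n + 2 - i) := by
    intro i hi hg
    rw [Finset.mem_Icc] at hi
    obtain ⟨j, rfl⟩ : ∃ j, i = j + 1 := ⟨i - 1, by omega⟩
    have hj : j ≤ n := by omega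
    have h1 := hco j hj
    apply mul_left_cancel₀ (dne j hj hg)
    rw [h1, show n + 2 - (j + 1) = n - j + 1 by omega]
    ring
  have huv : u = 0 ∧ v = 0 := by
    by_contra hne
    have hinvar : ∀ x b a, Qp n (dco n γ) x b = Qp n (dco n γ) (x + u * a) (b + v * a) := by
      intro x b a
      have h1 := hsc (x / t) a (b / s)
      rw [hsc0, mul_div_cancel₀ _ ht, mul_div_cancel₀ _ hs, add_comm (v * a)] at h1
      exact mul_right_cancel₀ (mul_ne_zero hs ht) h1
    have k1 : ∃ j ≤ n, 1 ≤ j ∧ dco n γ j ≠ 0 := by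
      obtain ⟨i, hi, hi2, hg⟩ := hhi
      rw [Finset.mem_Icc] at hi
      obtain ⟨j, rfl⟩ : ∃ j, i = j + 1 := ⟨i - 1, by omega⟩
      exact ⟨j, by omega, by omega, dne j (by omega) hg⟩
    have k2 : ∃ j < n, dco n γ j ≠ 0 := by
      obtain ⟨i, hi, hi2, hg⟩ := hlo
      rw [Finset.mem_Icc] at hi
      obtain ⟨j, rfl⟩ : ∃ j, i = j + 1 := ⟨i - 1, by omega⟩
      exact ⟨j, by omega, dne j (by omega) hg⟩
    obtain ⟨hu, hv, hQ, hd⟩ := Qp_inv hinvar k1 k2 hne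
    have h0 : dco n γ 0 ≠ 0 := by
      obtain ⟨j, hj, hdj⟩ := k2
      intro h
      apply hdj
      rw [hd j hj.le, h]; ring
    exact hu (special_case hn hΞ hH hB Ξ0 ht hs hE hu hv h0 hQ hd)
  exact ⟨huv.1, Hx, Ab, huv.2, Aa, hfin⟩
end
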